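/- arXiv:2006.06089 — 4 statements merged into one kernel-verified Lean document; each statement's English description precedes it below -/
import Mathlib

section
/- Let $1<s<2$ and $n>2s$. For every $C_0>0$ there exists $C=C(n,s,C_0)>0$ with the following property: if $f:\mathbb{R}^n\to[0,\infty)$ is measurable and satisfies $\int_{B_r} f(z)\,dz \le C_0\, r^{n-2s}$ for every $r\ge 1$, and $w(x):=\int_{\mathbb{R}^n}\Big(\frac{1}{|x-z|^{n-2s}}-\frac{1}{(1+|z|)^{n-2s}}\Big)f(z)\,dz$ (the integral being absolutely convergent for almost every $x$), then $\int_{\mathbb{R}^n}\frac{|w(x)|}{1+|x|^{n+2s}}\,dx \le C$. -/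
open MeasureTheory Metric Filter Set

noncomputable section

/-- Euclidean space `ℝ^n`. -/
abbrev En (n : ℕ) : Type := EuclideanSpace ℝ (Fin n)

/-- Mean value bound for the negative power `t ↦ t ^ (-a)` away from the origin. -/
lemma abs_one_div_rpow_sub_le {a ρ u v : ℝ} (ha : 0 < a) (hρ : 0 < ρ) (hu : ρ ≤ u) (hv : ρ ≤ v) :
    |1 / u ^ a - 1 / v ^ a| ≤ a * ρ ^ (-a - 1) * |u - v| := by
  have hpow : ∀ t, ρ ≤ t → 1 / t ^ a = t ^ (-a) := fun t ht => by
    rw [Real.rpow_neg (hρ.le.trans ht), one_div]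
  rw [hpow u hu, hpow v hv]
  refine (convex_Ici ρ).norm_image_sub_le_of_norm_hasDerivWithin_le
    (f := fun t : ℝ => t ^ (-a)) (f' := fun t => -a * t ^ (-a - 1))
    (fun t ht => ?_) (fun t ht => ?_) hv hu
  · exact (Real.hasDerivAt_rpow_const (Or.inl (hρ.trans_le ht).ne')).hasDerivWithinAt
  · have ht0 : 0 < t := hρ.trans_le ht
    rw [norm_mul, norm_neg, Real.norm_of_nonneg ha.le,
      Real.norm_of_nonneg (Real.rpow_nonneg ht0.le _)]
    exact mul_le_mul_of_nonneg_left
      (Real.rpow_le_rpow_of_nonpos hρ ht (by linarith)) ha.le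

lemma one_div_one_add_rpow_le {p X : ℝ} (hp : 0 < p) (hX : 0 ≤ X) :
    1 / (1 + X ^ p) ≤ 2 ^ p * (1 + X) ^ (-p) := by
  have hXp : 0 ≤ X ^ p := Real.rpow_nonneg hX p
  have h1 : (1 + X) ^ p ≤ 2 ^ p * (1 + X ^ p) := by
    rcases le_total X 1 with h | h
    · calc (1 + X) ^ p ≤ 2 ^ p := Real.rpow_le_rpow (by linarith) (by linarith) hp.le
        _ ≤ 2 ^ p * (1 + X ^ p) := le_mul_of_one_le_right (by positivity) (by linarith)
    · calc (1 + X) ^ p ≤ (2 * X) ^ p := Real.rpow_le_rpow (by linarith) (by linarith) hp.le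
        _ = 2 ^ p * X ^ p := Real.mul_rpow (by norm_num) hX
        _ ≤ 2 ^ p * (1 + X ^ p) := by gcongr; linarith
  rw [Real.rpow_neg (by positivity), ← div_eq_mul_inv,
    div_le_div_iff₀ (by positivity) (by positivity)]
  linarith

/-- Pointwise bound on the weighted kernel, with a decaying far part and a singular near part. -/
lemma weighted_kernel_le {E : Type*} [NormedAddCommGroup E] {a p : ℝ} (ha : 0 < a) (hp : 1 < p)
    {x z : E} (hxz : x ≠ z) :
    |1 / ‖x - z‖ ^ a - 1 / (1 + ‖z‖) ^ a| / (1 + ‖x‖ ^ p) ≤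
      a * 2 ^ (a + 1 + p) * (1 + ‖z‖) ^ (-a - 1) * (1 + ‖x‖) ^ (-(p - 1)) +
      4 ^ p * (1 + ‖z‖) ^ (-p) *
        (ball (0 : E) (1 + ‖z‖)).indicator (fun y => ‖y‖ ^ (-a)) (x - z) := by
  set R := 1 + ‖z‖
  have hR0 : 0 < R := by positivity
  have hx := norm_nonneg x
  have hz := norm_nonneg z
  have hX0 : 0 < 1 + ‖x‖ := by positivity
  have hw := one_div_one_add_rpow_le (zero_lt_one.trans hp) hx
  have hind : 0 ≤ (ball (0 : E) R).indicator (fun y => ‖y‖ ^ (-a)) (x - z) :=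
    indicator_nonneg (fun y _ => Real.rpow_nonneg (norm_nonneg y) _) _
  rw [div_eq_mul_one_div]
  rcases le_or_gt (R / 2) ‖x - z‖ with h | h
  · have hdist : |‖x - z‖ - R| ≤ 1 + ‖x‖ := by
      have h1 := norm_sub_le x z
      have h2 := norm_sub_norm_le z x
      rw [norm_sub_rev] at h2
      rw [abs_le]
      constructor <;> linarith
    have hk : |1 / ‖x - z‖ ^ a - 1 / R ^ a| ≤ a * (R / 2) ^ (-a - 1) * (1 + ‖x‖) :=
      (abs_one_div_rpow_sub_le ha (by positivity) h (by linarith)).trans (by gcongr)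
    calc |1 / ‖x - z‖ ^ a - 1 / R ^ a| * (1 / (1 + ‖x‖ ^ p))
        ≤ (a * (R / 2) ^ (-a - 1) * (1 + ‖x‖)) * (2 ^ p * (1 + ‖x‖) ^ (-p)) := by gcongr
      _ = a * 2 ^ (a + 1 + p) * R ^ (-a - 1) * (1 + ‖x‖) ^ (-(p - 1)) := by
          have e1 : (R / 2) ^ (-a - 1) = R ^ (-a - 1) * 2 ^ (a + 1) := by
            rw [Real.div_rpow hR0.le (by norm_num), div_eq_mul_inv,
              ← Real.rpow_neg (by norm_num)]
            congr 2
            ring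
          have e2 : (1 + ‖x‖) ^ (-(p - 1)) = (1 + ‖x‖) * (1 + ‖x‖) ^ (-p) := by
            rw [← Real.rpow_one_add' hX0.le (by intro h0; linarith)]
            congr 1
            ring
          rw [e1, e2, Real.rpow_add (by norm_num) (a + 1) p]
          ring
      _ ≤ _ := le_add_of_nonneg_right (by positivity)
  · have hmem : x - z ∈ ball (0 : E) R := by
      rw [mem_ball_zero_iff]
      linarith
    have hxR : R / 2 ≤ 1 + ‖x‖ := by
      have h2 := norm_sub_norm_le z x
      rw [norm_sub_rev] at h2
      linarith
    have hk : |1 / ‖x - z‖ ^ a - 1 / R ^ a| ≤ ‖x - z‖ ^ (-a) := by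
      have hd : 0 < ‖x - z‖ := norm_pos_iff.2 (sub_ne_zero.2 hxz)
      have hle : 1 / R ^ a ≤ 1 / ‖x - z‖ ^ a :=
        one_div_le_one_div_of_le (by positivity)
          (Real.rpow_le_rpow hd.le (by linarith) ha.le)
      rw [abs_of_nonneg (sub_nonneg.2 hle), Real.rpow_neg hd.le, ← one_div]
      exact sub_le_self _ (by positivity)
    have hwR : (1 + ‖x‖) ^ (-p) ≤ 2 ^ p * R ^ (-p) := by
      calc (1 + ‖x‖) ^ (-p) ≤ (R / 2) ^ (-p) :=
            Real.rpow_le_rpow_of_nonpos (by positivity) hxR (by linarith)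
        _ = 2 ^ p * R ^ (-p) := by
            rw [Real.div_rpow hR0.le (by norm_num), Real.rpow_neg (by norm_num : (0:ℝ) ≤ 2),
              div_inv_eq_mul, mul_comm]
    rw [indicator_of_mem hmem]
    calc |1 / ‖x - z‖ ^ a - 1 / R ^ a| * (1 / (1 + ‖x‖ ^ p))
        ≤ ‖x - z‖ ^ (-a) * (2 ^ p * (2 ^ p * R ^ (-p))) := by
          gcongr
          exact hw.trans (by gcongr)
      _ = 4 ^ p * R ^ (-p) * ‖x - z‖ ^ (-a) := by
          rw [show (4 : ℝ) = 2 * 2 by norm_num, Real.mul_rpow (by norm_num) (by norm_num)]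
          ring
      _ ≤ _ := le_add_of_nonneg_left (by positivity)

/-- Scaling of the integral of a negative power of the norm over balls. -/
lemma setLIntegral_ball_norm_rpow {n : ℕ} {a R : ℝ} (hR : 0 < R) :
    ∫⁻ y in ball (0 : En n) R, ENNReal.ofReal (‖y‖ ^ (-a)) =
      ENNReal.ofReal (R ^ ((n : ℝ) - a)) *
        ∫⁻ y in ball (0 : En n) 1, ENNReal.ofReal (‖y‖ ^ (-a)) := by
  have hmeas : Measurable fun y : En n => ENNReal.ofReal (‖y‖ ^ (-a)) := by fun_prop
  have hmap := Measure.map_addHaar_smul (volume : Measure (En n)) hR.ne'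
  rw [finrank_euclideanSpace_fin, abs_of_pos (by positivity)] at hmap
  have hpt : ∀ y : En n,
      (ball (0 : En n) R).indicator (fun y => ENNReal.ofReal (‖y‖ ^ (-a))) (R • y) =
        ENNReal.ofReal (R ^ (-a)) *
          (ball (0 : En n) 1).indicator (fun y => ENNReal.ofReal (‖y‖ ^ (-a))) y := by
    intro y
    have hiff : R • y ∈ ball (0 : En n) R ↔ y ∈ ball (0 : En n) 1 := by
      rw [mem_ball_zero_iff, mem_ball_zero_iff, norm_smul, Real.norm_of_nonneg hR.le]
      exact mul_lt_iff_lt_one_right hR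
    by_cases hy : y ∈ ball (0 : En n) 1
    · rw [indicator_of_mem hy, indicator_of_mem (hiff.2 hy), norm_smul,
        Real.norm_of_nonneg hR.le, Real.mul_rpow hR.le (norm_nonneg y),
        ENNReal.ofReal_mul (by positivity)]
    · rw [indicator_of_notMem hy, indicator_of_notMem (fun h => hy (hiff.1 h)), mul_zero]
  have hscale : ENNReal.ofReal (R ^ n)⁻¹ *
      ∫⁻ y in ball (0 : En n) R, ENNReal.ofReal (‖y‖ ^ (-a)) =
      ENNReal.ofReal (R ^ (-a)) *
        ∫⁻ y in ball (0 : En n) 1, ENNReal.ofReal (‖y‖ ^ (-a)) := by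
    rw [← lintegral_indicator measurableSet_ball, ← lintegral_indicator measurableSet_ball,
      ← smul_eq_mul, ← lintegral_smul_measure, ← hmap,
      lintegral_map (hmeas.indicator measurableSet_ball) (measurable_const_smul R),
      ← lintegral_const_mul _ (hmeas.indicator measurableSet_ball)]
    exact lintegral_congr hpt
  calc ∫⁻ y in ball (0 : En n) R, ENNReal.ofReal (‖y‖ ^ (-a))
      = ENNReal.ofReal (R ^ n) * (ENNReal.ofReal (R ^ n)⁻¹ *
          ∫⁻ y in ball (0 : En n) R, ENNReal.ofReal (‖y‖ ^ (-a))) := by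
        rw [← mul_assoc, ← ENNReal.ofReal_mul (by positivity),
          mul_inv_cancel₀ (by positivity), ENNReal.ofReal_one, one_mul]
    _ = _ := by
        rw [hscale, ← mul_assoc, ← ENNReal.ofReal_mul (by positivity), sub_eq_add_neg,
          Real.rpow_add hR, Real.rpow_natCast]

lemma setLIntegral_ball_norm_rpow_lt_top {n : ℕ} {a : ℝ} (hn : 1 ≤ n) (ha : a < n) :
    ∫⁻ y in ball (0 : En n) 1, ENNReal.ofReal (‖y‖ ^ (-a)) < ⊤ := by
  have hint : IntegrableOn (fun y : En n => ‖y‖ ^ (-a)) (ball 0 1) :=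
    integrableOn_ball_of_norm_le_rpow (C := 1) (α := a) (by simpa using hn) (by simpa using ha)
      (Eventually.of_forall fun y => by
        rw [one_mul, Real.norm_of_nonneg (Real.rpow_nonneg (norm_nonneg y) _)])
      (measurable_norm.pow_const (-a)).aestronglyMeasurable
  exact hint.lintegral_lt_top

/-- A measure with growth exponent `a` has a uniformly bounded integral against
`(1 + ‖z‖) ^ (-a - 1)`. -/
lemma lintegral_mul_rpow_le_of_growth {n : ℕ} {a C₀ : ℝ} (ha : 0 < a) (hC₀ : 0 < C₀)
    {f : En n → ENNReal} (hf : Measurable f)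
    (hgrowth : ∀ r : ℝ, 1 ≤ r → ∫⁻ z in ball (0 : En n) r, f z ≤ ENNReal.ofReal (C₀ * r ^ a)) :
    ∫⁻ z, f z * ENNReal.ofReal ((1 + ‖z‖) ^ (-a - 1)) ≤ ENNReal.ofReal (C₀ * 2 ^ a * 2) := by
  have hpt : ∀ z : En n, f z * ENNReal.ofReal ((1 + ‖z‖) ^ (-a - 1)) ≤
      ∑' k : ℕ, ENNReal.ofReal (((2 : ℝ) ^ k) ^ (-a - 1)) *
        (ball (0 : En n) (2 ^ (k + 1))).indicator f z := by
    intro z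
    obtain ⟨k, hk1, hk2⟩ := exists_nat_pow_near
      (show (1 : ℝ) ≤ 1 + ‖z‖ by linarith [norm_nonneg z]) (show (1 : ℝ) < 2 by norm_num)
    have hz : z ∈ ball (0 : En n) (2 ^ (k + 1)) := by
      rw [mem_ball_zero_iff]
      linarith
    refine le_trans ?_ (ENNReal.le_tsum k)
    rw [indicator_of_mem hz, mul_comm]
    gcongr ENNReal.ofReal ?_ * _
    exact Real.rpow_le_rpow_of_nonpos (by positivity) hk1 (by linarith)
  have hterm : ∀ k : ℕ, ∫⁻ z, ENNReal.ofReal (((2 : ℝ) ^ k) ^ (-a - 1)) *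
      (ball (0 : En n) (2 ^ (k + 1))).indicator f z ≤
        ENNReal.ofReal (C₀ * 2 ^ a * (1 / 2) ^ k) := by
    intro k
    rw [lintegral_const_mul _ (hf.indicator measurableSet_ball),
      lintegral_indicator measurableSet_ball]
    refine (mul_le_mul_right (hgrowth _ (one_le_pow₀ (by norm_num))) _).trans_eq ?_
    rw [← ENNReal.ofReal_mul (by positivity)]
    congr 1
    have h2k : (0 : ℝ) < 2 ^ k := by positivity
    rw [pow_succ, Real.mul_rpow h2k.le (by norm_num), sub_eq_add_neg, Real.rpow_add h2k,
      Real.rpow_neg h2k.le a, Real.rpow_neg_one, one_div, inv_pow]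
    field_simp
  calc ∫⁻ z, f z * ENNReal.ofReal ((1 + ‖z‖) ^ (-a - 1))
      ≤ ∫⁻ z, ∑' k : ℕ, ENNReal.ofReal (((2 : ℝ) ^ k) ^ (-a - 1)) *
          (ball (0 : En n) (2 ^ (k + 1))).indicator f z := lintegral_mono hpt
    _ = ∑' k : ℕ, ∫⁻ z, ENNReal.ofReal (((2 : ℝ) ^ k) ^ (-a - 1)) *
          (ball (0 : En n) (2 ^ (k + 1))).indicator f z :=
        lintegral_tsum fun k => ((hf.indicator measurableSet_ball).const_mul _).aemeasurable
    _ ≤ ∑' k : ℕ, ENNReal.ofReal (C₀ * 2 ^ a * (1 / 2) ^ k) := ENNReal.tsum_le_tsum hterm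
    _ = ENNReal.ofReal (C₀ * 2 ^ a * 2) := by
        rw [← ENNReal.ofReal_tsum_of_nonneg (fun k => by positivity)
          (summable_geometric_two.mul_left _), tsum_mul_left, tsum_geometric_two]

/-- The weighted integral in `x` of the kernel decays faster than `(1 + ‖z‖) ^ (-a)`. -/
lemma exists_lintegral_weighted_kernel_le {n : ℕ} {a p : ℝ} (hn : 1 ≤ n) (ha : 0 < a)
    (han : a < n) (hp : (n : ℝ) + 1 < p) :
    ∃ B : ENNReal, B < ⊤ ∧ ∀ z : En n,
      ∫⁻ x : En n, ENNReal.ofReal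
        (|1 / ‖x - z‖ ^ a - 1 / (1 + ‖z‖) ^ a| / (1 + ‖x‖ ^ p)) ≤
        B * ENNReal.ofReal ((1 + ‖z‖) ^ (-a - 1)) := by
  have : Nontrivial (En n) := by
    have : Nonempty (Fin n) := ⟨⟨0, hn⟩⟩
    infer_instance
  set J : ENNReal := ∫⁻ x : En n, ENNReal.ofReal ((1 + ‖x‖) ^ (-(p - 1)))
  set M : ENNReal := ∫⁻ y in ball (0 : En n) 1, ENNReal.ofReal (‖y‖ ^ (-a))
  have hJ_top : J < ⊤ := finite_integral_one_add_norm (by simpa using by linarith)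
  have hM_top : M < ⊤ := setLIntegral_ball_norm_rpow_lt_top hn han
  refine ⟨ENNReal.ofReal (a * 2 ^ (a + 1 + p)) * J + ENNReal.ofReal (4 ^ p) * M,
    ENNReal.add_lt_top.2 ⟨ENNReal.mul_lt_top ENNReal.ofReal_lt_top hJ_top,
      ENNReal.mul_lt_top ENNReal.ofReal_lt_top hM_top⟩, fun z => ?_⟩
  set R := 1 + ‖z‖
  have hR1 : 1 ≤ R := by linarith [norm_nonneg z]
  have hR0 : 0 < R := by linarith
  have hnear : Measurable ((ball (0 : En n) R).indicator
      fun y => ENNReal.ofReal (‖y‖ ^ (-a))) :=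
    Measurable.indicator (by fun_prop) measurableSet_ball
  have hnear_sub : Measurable fun x : En n => (ball (0 : En n) R).indicator
      (fun y => ENNReal.ofReal (‖y‖ ^ (-a))) (x - z) :=
    hnear.comp (measurable_id.sub_const z)
  have hpt : ∀ᵐ x : En n, ENNReal.ofReal
      (|1 / ‖x - z‖ ^ a - 1 / R ^ a| / (1 + ‖x‖ ^ p)) ≤
      ENNReal.ofReal (a * 2 ^ (a + 1 + p) * R ^ (-a - 1)) *
        ENNReal.ofReal ((1 + ‖x‖) ^ (-(p - 1))) +
      ENNReal.ofReal (4 ^ p * R ^ (-p)) *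
        (ball (0 : En n) R).indicator (fun y => ENNReal.ofReal (‖y‖ ^ (-a))) (x - z) := by
    filter_upwards [Measure.ae_ne volume z] with x hx
    refine (ENNReal.ofReal_le_ofReal (weighted_kernel_le ha (by linarith) hx)).trans ?_
    refine ENNReal.ofReal_add_le.trans ?_
    rw [ENNReal.ofReal_mul (by positivity),
      ENNReal.ofReal_mul (p := 4 ^ p * (1 + ‖z‖) ^ (-p)) (by positivity)]
    refine add_le_add le_rfl (mul_le_mul_right (le_of_eq ?_) _)
    by_cases h : x - z ∈ ball (0 : En n) R
    · rw [indicator_of_mem h, indicator_of_mem h]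
    · rw [indicator_of_notMem h, indicator_of_notMem h, ENNReal.ofReal_zero]
  have hfar : Measurable fun x : En n => ENNReal.ofReal ((1 + ‖x‖) ^ (-(p - 1))) := by fun_prop
  calc ∫⁻ x : En n, ENNReal.ofReal (|1 / ‖x - z‖ ^ a - 1 / R ^ a| / (1 + ‖x‖ ^ p))
      ≤ _ := lintegral_mono_ae hpt
    _ = ENNReal.ofReal (a * 2 ^ (a + 1 + p) * R ^ (-a - 1)) * J +
          ENNReal.ofReal (4 ^ p * R ^ (-p)) * (ENNReal.ofReal (R ^ ((n : ℝ) - a)) * M) := by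
        rw [lintegral_add_left (hfar.const_mul _), lintegral_const_mul _ hfar,
          lintegral_const_mul _ hnear_sub,
          lintegral_sub_right_eq_self
            ((ball (0 : En n) R).indicator fun y => ENNReal.ofReal (‖y‖ ^ (-a))) z,
          lintegral_indicator measurableSet_ball, setLIntegral_ball_norm_rpow hR0]
    _ ≤ ENNReal.ofReal (a * 2 ^ (a + 1 + p) * R ^ (-a - 1)) * J +
          ENNReal.ofReal (4 ^ p * R ^ (-a - 1)) * M := by
        rw [← mul_assoc, ← ENNReal.ofReal_mul (by positivity), mul_assoc (4 ^ p),
          ← Real.rpow_add hR0]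
        gcongr
        linarith
    _ = _ := by
        rw [ENNReal.ofReal_mul (p := a * 2 ^ (a + 1 + p)) (by positivity),
          ENNReal.ofReal_mul (p := 4 ^ p) (by positivity)]
        ring

lemma measurable_weighted_kernel {E : Type*} [NormedAddCommGroup E] [MeasurableSpace E]
    [BorelSpace E] [SecondCountableTopology E] {a p : ℝ} :
    Measurable fun q : E × E => ENNReal.ofReal
      (|1 / ‖q.1 - q.2‖ ^ a - 1 / (1 + ‖q.2‖) ^ a| / (1 + ‖q.1‖ ^ p)) := by
  have h1 : Measurable fun q : E × E => 1 / ‖q.1 - q.2‖ ^ a :=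
    ((measurable_fst.sub measurable_snd).norm.pow_const a).const_div 1
  have h2 : Measurable fun q : E × E => 1 / (1 + ‖q.2‖) ^ a :=
    ((measurable_snd.norm.const_add 1).pow_const a).const_div 1
  have h3 : Measurable fun q : E × E => 1 + ‖q.1‖ ^ p :=
    (measurable_fst.norm.pow_const p).const_add 1
  exact ((measurable_norm.comp (h1.sub h2)).div h3).ennreal_ofReal

/-- Weighted bound for the potential `w`, with the exponents of kernel and weight decoupled. -/
lemma lintegral_potential_le {n : ℕ} {a p C₀ : ℝ} (ha : 0 < a) (hC₀ : 0 < C₀) {B : ENNReal}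
    (hB_top : B < ⊤)
    (hB : ∀ z : En n, ∫⁻ x : En n, ENNReal.ofReal
      (|1 / ‖x - z‖ ^ a - 1 / (1 + ‖z‖) ^ a| / (1 + ‖x‖ ^ p)) ≤
        B * ENNReal.ofReal ((1 + ‖z‖) ^ (-a - 1)))
    {f w : En n → ℝ} (hf : Measurable f) (hf0 : ∀ x, 0 ≤ f x)
    (hgrowth : ∀ r : ℝ, 1 ≤ r → ∫⁻ z in ball (0 : En n) r, ENNReal.ofReal (f z) ≤
      ENNReal.ofReal (C₀ * r ^ a))
    (hw : ∀ x, w x = ∫ z : En n, (1 / ‖x - z‖ ^ a - 1 / (1 + ‖z‖) ^ a) * f z) :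
    ∫⁻ x : En n, ENNReal.ofReal (|w x| / (1 + ‖x‖ ^ p)) ≤
      ENNReal.ofReal (B.toReal * (C₀ * 2 ^ a * 2)) := by
  have hfm : Measurable fun z => ENNReal.ofReal (f z) := hf.ennreal_ofReal
  obtain ⟨K, hK⟩ : ∃ K : En n → En n → ENNReal, ∀ x z, K x z = ENNReal.ofReal
      (|1 / ‖x - z‖ ^ a - 1 / (1 + ‖z‖) ^ a| / (1 + ‖x‖ ^ p)) := ⟨_, fun _ _ => rfl⟩
  simp only [← hK] at hB
  have hKm : Measurable fun q : En n × En n => K q.1 q.2 := by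
    simpa only [hK] using measurable_weighted_kernel
  have hKz : ∀ z, Measurable fun x => K x z := fun z =>
    hKm.comp (measurable_id.prodMk measurable_const)
  have hprod : Measurable fun q : En n × En n => ENNReal.ofReal (f q.2) * K q.1 q.2 :=
    (hfm.comp measurable_snd).mul hKm
  have hpt : ∀ x, ENNReal.ofReal (|w x| / (1 + ‖x‖ ^ p)) ≤
      ∫⁻ z, ENNReal.ofReal (f z) * K x z := by
    intro x
    have hden : (0 : ℝ) < 1 + ‖x‖ ^ p := by positivity
    have hscale : w x / (1 + ‖x‖ ^ p) = ∫ z : En n,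
        (1 / ‖x - z‖ ^ a - 1 / (1 + ‖z‖) ^ a) * f z / (1 + ‖x‖ ^ p) := by
      rw [hw x, integral_div]
    rw [← abs_of_pos hden, ← abs_div, ← Real.enorm_eq_ofReal_abs, hscale]
    refine (enorm_integral_le_lintegral_enorm _).trans_eq (lintegral_congr fun z => ?_)
    rw [hK, Real.enorm_eq_ofReal_abs, abs_div, abs_mul, abs_of_nonneg (hf0 z), abs_of_pos hden,
      ← ENNReal.ofReal_mul (hf0 z)]
    congr 1
    ring
  calc ∫⁻ x : En n, ENNReal.ofReal (|w x| / (1 + ‖x‖ ^ p))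
      ≤ ∫⁻ x, ∫⁻ z, ENNReal.ofReal (f z) * K x z := lintegral_mono hpt
    _ = ∫⁻ z, ∫⁻ x, ENNReal.ofReal (f z) * K x z :=
        lintegral_lintegral_swap hprod.aemeasurable
    _ ≤ ∫⁻ z, B * (ENNReal.ofReal (f z) * ENNReal.ofReal ((1 + ‖z‖) ^ (-a - 1))) := by
        refine lintegral_mono fun z => ?_
        rw [lintegral_const_mul _ (hKz z), mul_left_comm]
        exact mul_le_mul_right (hB z) _
    _ = B * ∫⁻ z, ENNReal.ofReal (f z) * ENNReal.ofReal ((1 + ‖z‖) ^ (-a - 1)) :=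
        lintegral_const_mul' _ _ hB_top.ne
    _ ≤ B * ENNReal.ofReal (C₀ * 2 ^ a * 2) :=
        mul_le_mul_right (lintegral_mul_rpow_le_of_growth ha hC₀ hfm hgrowth) _
    _ = ENNReal.ofReal (B.toReal * (C₀ * 2 ^ a * 2)) := by
        rw [ENNReal.ofReal_mul ENNReal.toReal_nonneg, ENNReal.ofReal_toReal hB_top.ne]

/-- (Lemma 4.4, estimate (4.4), of the paper.) Let `1 < s < 2` and
`n > 2s`.  For every `C₀ > 0` there is `C > 0` such that: if `f : ℝ^n → [0,∞)` is
measurable with `∫_{B_r} f ≤ C₀ r^{n-2s}` for every `r ≥ 1`, and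
`w(x) = ∫ (|x-z|^{-(n-2s)} - (1+|z|)^{-(n-2s)}) f(z) dz` (the integral being absolutely
convergent for a.e. `x`), then `∫ |w(x)|/(1+|x|^{n+2s}) dx ≤ C`. -/
theorem newtonian_potential_weighted_bound
    (n : ℕ) (s : ℝ) (hs1 : 1 < s) (hs2 : s < 2) (hn : 2 * s < (n : ℝ)) :
    ∀ C₀ > (0:ℝ), ∃ C > (0:ℝ),
      ∀ f : En n → ℝ, Measurable f → (∀ x, 0 ≤ f x) →
        (∀ r : ℝ, 1 ≤ r →
          ∫⁻ z in Metric.ball (0 : En n) r, ENNReal.ofReal (f z) ≤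
            ENNReal.ofReal (C₀ * r ^ ((n : ℝ) - 2 * s))) →
        (∀ᵐ x : En n,
          MeasureTheory.Integrable (fun z : En n =>
            (1 / ‖x - z‖ ^ ((n : ℝ) - 2 * s) - 1 / (1 + ‖z‖) ^ ((n : ℝ) - 2 * s)) * f z)) →
        ∀ w : En n → ℝ,
          (∀ x, w x = ∫ z : En n,
            (1 / ‖x - z‖ ^ ((n : ℝ) - 2 * s) - 1 / (1 + ‖z‖) ^ ((n : ℝ) - 2 * s)) * f z) →
          ∫⁻ x : En n, ENNReal.ofReal (|w x| / (1 + ‖x‖ ^ ((n : ℝ) + 2 * s))) ≤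
            ENNReal.ofReal C := by
  intro C₀ hC₀
  have ha : 0 < (n : ℝ) - 2 * s := by linarith
  have hn1 : 1 ≤ n := by
    have : (0 : ℝ) < n := by linarith
    exact_mod_cast this
  obtain ⟨B, hB_top, hB⟩ := exists_lintegral_weighted_kernel_le
    (a := (n : ℝ) - 2 * s) (p := (n : ℝ) + 2 * s) hn1 ha (by linarith) (by linarith)
  refine ⟨B.toReal * (C₀ * 2 ^ ((n : ℝ) - 2 * s) * 2) + 1, by positivity, ?_⟩
  intro f hf hf0 hgrowth _ w hw
  exact (lintegral_potential_le ha hC₀ hB_top hB hf hf0 hgrowth hw).trans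
    (ENNReal.ofReal_le_ofReal (by linarith))
end
end

section
/- Let $1<s<2$ and $n>2s$. For every $C_0>0$ there exists $C=C(n,s,C_0)>0$ with the following property: if $f:\mathbb{R}^n\to[0,\infty)$ is measurable and satisfies $\int_{B_r} f(z)\,dz \le C_0\, r^{n-2s}$ for every $r\ge 1$, and $v(x):=\int_{\mathbb{R}^n}\frac{f(z)}{|x-z|^{n-s}}\,dz$, then $\int_{\mathbb{R}^n}\frac{v(x)}{1+|x|^{n+s}}\,dx \le C$. -/
open MeasureTheory Metric Filter Set

noncomputable section

lemma lintegral_norm_rpow_neg_ball_lt_top {n : ℕ} {a : ℝ} (hn : 0 < n) (ha : a < n) :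
    ∫⁻ y in ball (0 : En n) 1, ENNReal.ofReal (‖y‖ ^ (-a)) < ⊤ := by
  have : Nonempty (Fin n) := ⟨⟨0, hn⟩⟩
  have h : IntegrableOn (fun y : En n => ‖y‖ ^ (-a)) (ball 0 1) := by
    rw [integrableOn_fun_norm_addHaar (E := En n) volume (f := fun t : ℝ => t ^ (-a))]
    have h1 : IntegrableOn (fun t : ℝ => t ^ ((n : ℝ) - 1 - a)) (Ioo 0 1) := by
      rw [← integrableOn_Ioc_iff_integrableOn_Ioo,
        ← intervalIntegrable_iff_integrableOn_Ioc_of_le zero_le_one]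
      exact intervalIntegral.intervalIntegrable_rpow' (by linarith)
    refine h1.congr_fun (fun t ht => ?_) measurableSet_Ioo
    have e : ((n - 1 : ℕ) : ℝ) = (n : ℝ) - 1 := by
      rw [Nat.cast_sub hn, Nat.cast_one]
    simp only [finrank_euclideanSpace, Fintype.card_fin, smul_eq_mul]
    rw [← Real.rpow_natCast, ← Real.rpow_add ht.1, e, sub_eq_add_neg _ a]
  exact h.setLIntegral_lt_top

lemma lintegral_norm_rpow_neg_ball {n : ℕ} (a : ℝ) {ρ : ℝ} (hρ : 0 < ρ) :
    ∫⁻ y in ball (0 : En n) ρ, ENNReal.ofReal (‖y‖ ^ (-a)) =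
      ENNReal.ofReal (ρ ^ ((n : ℝ) - a)) *
        ∫⁻ y in ball (0 : En n) 1, ENNReal.ofReal (‖y‖ ^ (-a)) := by
  have hvol : (volume : Measure (En n)) =
      ENNReal.ofReal (ρ ^ n) • Measure.map (ρ • ·) volume := by
    rw [Measure.map_addHaar_smul _ hρ.ne', smul_smul, finrank_euclideanSpace, Fintype.card_fin,
      ← ENNReal.ofReal_mul (by positivity), abs_of_pos (by positivity),
      mul_inv_cancel₀ (by positivity), ENNReal.ofReal_one, one_smul]
  have hmeas : Measurable
      ((ball (0 : En n) ρ).indicator fun y => ENNReal.ofReal (‖y‖ ^ (-a))) :=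
    Measurable.indicator (by fun_prop) measurableSet_ball
  have hpt (y : En n) :
      (ball (0 : En n) ρ).indicator (fun y => ENNReal.ofReal (‖y‖ ^ (-a))) (ρ • y) =
        ENNReal.ofReal (ρ ^ (-a)) *
          (ball (0 : En n) 1).indicator (fun y => ENNReal.ofReal (‖y‖ ^ (-a))) y := by
    have hn : ‖ρ • y‖ = ρ * ‖y‖ := by rw [norm_smul, Real.norm_of_nonneg hρ.le]
    have hiff : ρ • y ∈ ball (0 : En n) ρ ↔ y ∈ ball (0 : En n) 1 := by
      rw [mem_ball_zero_iff, mem_ball_zero_iff, hn]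
      exact mul_lt_iff_lt_one_right hρ
    by_cases hy : y ∈ ball (0 : En n) 1
    · rw [indicator_of_mem hy, indicator_of_mem (hiff.2 hy), hn,
        ← ENNReal.ofReal_mul (by positivity), Real.mul_rpow hρ.le (norm_nonneg y)]
    · rw [indicator_of_notMem hy, indicator_of_notMem (mt hiff.1 hy), mul_zero]
  rw [← lintegral_indicator measurableSet_ball, ← lintegral_indicator measurableSet_ball]
  conv_lhs => rw [hvol]
  rw [lintegral_smul_measure, lintegral_map hmeas (measurable_const_smul ρ)]
  simp_rw [hpt]
  rw [lintegral_const_mul' _ _ ENNReal.ofReal_ne_top, smul_eq_mul, ← mul_assoc,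
    ← ENNReal.ofReal_mul (by positivity), ← Real.rpow_natCast, ← Real.rpow_add hρ,
    ← sub_eq_add_neg]

lemma one_add_rpow_le {t p : ℝ} (ht : 0 ≤ t) (hp : 0 ≤ p) :
    (1 + t) ^ p ≤ 2 ^ p * (1 + t ^ p) := by
  have htp : 0 ≤ t ^ p := Real.rpow_nonneg ht p
  rcases le_total t 1 with h | h
  · calc (1 + t) ^ p ≤ 2 ^ p := Real.rpow_le_rpow (by linarith) (by linarith) hp
      _ ≤ 2 ^ p * (1 + t ^ p) := le_mul_of_one_le_right (by positivity) (by linarith)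
  · calc (1 + t) ^ p ≤ (2 * t) ^ p := Real.rpow_le_rpow (by linarith) (by linarith) hp
      _ = 2 ^ p * t ^ p := Real.mul_rpow (by norm_num) ht
      _ ≤ 2 ^ p * (1 + t ^ p) := by gcongr; linarith

/-- The Riesz potential of the weight `(1 + ‖x‖) ^ (-p)`, `p > n`, decays like the Riesz kernel. -/
lemma exists_lintegral_riesz_kernel_mul_weight_le {n : ℕ} {a p : ℝ} (hn : 0 < n) (ha₀ : 0 < a)
    (ha : a < n) (hp : (n : ℝ) < p) :
    ∃ K : ENNReal, K ≠ ⊤ ∧ ∀ z : En n,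
      ∫⁻ x : En n, ENNReal.ofReal (‖x - z‖ ^ (-a)) * ENNReal.ofReal ((1 + ‖x‖) ^ (-p)) ≤
        K * ENNReal.ofReal ((1 + ‖z‖) ^ (-a)) := by
  set W := ∫⁻ x : En n, ENNReal.ofReal ((1 + ‖x‖) ^ (-p)) with hW
  set I := ∫⁻ y in ball (0 : En n) 1, ENNReal.ofReal (‖y‖ ^ (-a)) with hI
  have hWtop : W ≠ ⊤ := (finite_integral_one_add_norm (by simpa using hp)).ne
  have hItop : I ≠ ⊤ := (lintegral_norm_rpow_neg_ball_lt_top hn ha).ne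
  refine ⟨ENNReal.ofReal (2 ^ a) * W + ENNReal.ofReal (2 ^ p) * I, by finiteness, fun z => ?_⟩
  set R := 1 + ‖z‖ with hR
  have hz := norm_nonneg z
  have hR1 : 1 ≤ R := by linarith
  have hR0 : 0 < R / 2 := by linarith
  have hpt (x : En n) :
      ENNReal.ofReal (‖x - z‖ ^ (-a)) * ENNReal.ofReal ((1 + ‖x‖) ^ (-p)) ≤
        ENNReal.ofReal ((R / 2) ^ (-a)) * ENNReal.ofReal ((1 + ‖x‖) ^ (-p)) +
          ENNReal.ofReal ((R / 2) ^ (-p)) *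
            (ball (0 : En n) (R / 2)).indicator (fun y => ENNReal.ofReal (‖y‖ ^ (-a))) (x - z) := by
    by_cases hx : x - z ∈ ball (0 : En n) (R / 2)
    · rw [indicator_of_mem hx]
      rw [mem_ball_zero_iff] at hx
      refine le_add_left ?_
      rw [mul_comm]
      gcongr ENNReal.ofReal ?_ * _
      refine Real.rpow_le_rpow_of_nonpos hR0 ?_ (by linarith [ha₀.trans ha])
      have := norm_sub_norm_le z x
      rw [norm_sub_rev] at this
      linarith
    · rw [mem_ball_zero_iff, not_lt] at hx
      refine le_add_right ?_
      gcongr ENNReal.ofReal ?_ * _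
      exact Real.rpow_le_rpow_of_nonpos hR0 hx (by linarith)
  calc _ ≤ ∫⁻ x : En n, _ := lintegral_mono hpt
    _ = ENNReal.ofReal ((R / 2) ^ (-a)) * W +
          ENNReal.ofReal ((R / 2) ^ (-p)) * (ENNReal.ofReal ((R / 2) ^ ((n : ℝ) - a)) * I) := by
        rw [lintegral_add_left (by fun_prop), lintegral_const_mul' _ _ ENNReal.ofReal_ne_top,
          lintegral_const_mul' _ _ ENNReal.ofReal_ne_top,
          lintegral_sub_right_eq_self (fun y : En n => (ball (0 : En n) (R / 2)).indicator
            (fun y => ENNReal.ofReal (‖y‖ ^ (-a))) y),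
          lintegral_indicator measurableSet_ball, lintegral_norm_rpow_neg_ball a hR0]
    _ ≤ ENNReal.ofReal (2 ^ a) * ENNReal.ofReal (R ^ (-a)) * W +
          ENNReal.ofReal (2 ^ p) * ENNReal.ofReal (R ^ (-a)) * I := by
        rw [← mul_assoc]
        simp_rw [← ENNReal.ofReal_mul (Real.rpow_nonneg hR0.le _),
          ← ENNReal.ofReal_mul (Real.rpow_nonneg zero_le_two _)]
        have key (q : ℝ) : (R / 2) ^ (-q) = 2 ^ q * R ^ (-q) := by
          rw [Real.div_rpow (by linarith) zero_le_two, Real.rpow_neg zero_le_two, div_inv_eq_mul,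
            mul_comm]
        have hB : (R / 2) ^ (-p) * (R / 2) ^ ((n : ℝ) - a) ≤ 2 ^ p * R ^ (-a) := by
          rw [← Real.rpow_add hR0, show -p + ((n : ℝ) - a) = -(p + a - n) by ring, key]
          gcongr <;> linarith
        exact add_le_add (mul_le_mul_left (ENNReal.ofReal_le_ofReal (key a).le) _)
          (mul_le_mul_left (ENNReal.ofReal_le_ofReal hB) _)
    _ = _ := by ring

lemma exists_lintegral_mul_weight_le {n : ℕ} {a b : ℝ} (ha : 0 < a) (hab : b < a) (C₀ : ℝ) :
    ∃ K : ENNReal, K ≠ ⊤ ∧ ∀ f : En n → ℝ, Measurable f →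
      (∀ r : ℝ, 1 ≤ r →
        ∫⁻ z in ball (0 : En n) r, ENNReal.ofReal (f z) ≤ ENNReal.ofReal (C₀ * r ^ b)) →
      ∫⁻ z : En n, ENNReal.ofReal (f z) * ENNReal.ofReal ((1 + ‖z‖) ^ (-a)) ≤ K := by
  have hq0 : (0 : ℝ) < 2 ^ (b - a) := by positivity
  have hq1 : (2 : ℝ) ^ (b - a) < 1 := Real.rpow_lt_one_of_one_lt_of_neg one_lt_two (by linarith)
  refine ⟨ENNReal.ofReal (2 ^ a) *
    ∑' k : ℕ, ENNReal.ofReal (C₀ * (2 ^ (b - a)) ^ k), ?_, fun f hf hball => ?_⟩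
  · refine ENNReal.mul_ne_top ENNReal.ofReal_ne_top ?_
    exact ((summable_geometric_of_lt_one hq0.le hq1).mul_left C₀).tsum_ofReal_ne_top
  have hpt (z : En n) : ENNReal.ofReal (f z) * ENNReal.ofReal ((1 + ‖z‖) ^ (-a)) ≤
      ENNReal.ofReal (2 ^ a) * ∑' k : ℕ, ENNReal.ofReal (((2 : ℝ) ^ k) ^ (-a)) *
        (ball (0 : En n) (2 ^ k)).indicator (fun z => ENNReal.ofReal (f z)) z := by
    obtain ⟨k, hk1, hk2⟩ := exists_nat_pow_near (x := 1 + ‖z‖) (y := (2 : ℝ))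
      (by linarith [norm_nonneg z]) one_lt_two
    refine le_trans ?_ (mul_le_mul_right (ENNReal.le_tsum (k + 1)) _)
    rw [indicator_of_mem (by rw [mem_ball_zero_iff]; linarith), ← mul_assoc,
      ← ENNReal.ofReal_mul (Real.rpow_nonneg zero_le_two a), mul_comm]
    gcongr ENNReal.ofReal ?_ * _
    calc (1 + ‖z‖) ^ (-a) ≤ ((2 : ℝ) ^ k) ^ (-a) :=
          Real.rpow_le_rpow_of_nonpos (by positivity) hk1 (by linarith)
      _ = 2 ^ a * ((2 : ℝ) ^ (k + 1)) ^ (-a) := by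
          rw [pow_succ, Real.mul_rpow (by positivity) zero_le_two, mul_left_comm,
            ← Real.rpow_add two_pos, add_neg_cancel, Real.rpow_zero, mul_one]
  calc _ ≤ ∫⁻ z : En n, _ := lintegral_mono hpt
    _ = ENNReal.ofReal (2 ^ a) * ∑' k : ℕ, ENNReal.ofReal (((2 : ℝ) ^ k) ^ (-a)) *
          ∫⁻ z in ball (0 : En n) (2 ^ k), ENNReal.ofReal (f z) := by
        rw [lintegral_const_mul' _ _ ENNReal.ofReal_ne_top, lintegral_tsum fun k =>
          ((hf.ennreal_ofReal.indicator measurableSet_ball).const_mul _).aemeasurable]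
        simp_rw [lintegral_const_mul' _ _ ENNReal.ofReal_ne_top,
          lintegral_indicator measurableSet_ball]
    _ ≤ _ := by
        gcongr with k
        refine (mul_le_mul_right (hball (2 ^ k) (one_le_pow₀ one_le_two)) _).trans ?_
        rw [← ENNReal.ofReal_mul (by positivity)]
        refine (congrArg ENNReal.ofReal ?_).le
        rw [mul_left_comm, ← Real.rpow_add (by positivity), ← Real.rpow_natCast,
          ← Real.rpow_mul zero_le_two, ← Real.rpow_natCast, ← Real.rpow_mul zero_le_two]
        congr 2
        ring

/-- (Lemma 4.6 of the paper.) Let `1 < s < 2` and `n > 2s`.  For every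
`C₀ > 0` there is `C > 0` such that: if `f : ℝ^n → [0,∞)` is measurable with
`∫_{B_r} f ≤ C₀ r^{n-2s}` for every `r ≥ 1`, and `v(x) = ∫ f(z)/|x-z|^{n-s} dz`, then
`∫ v(x)/(1+|x|^{n+s}) dx ≤ C`. -/
theorem riesz_potential_weighted_bound
    (n : ℕ) (s : ℝ) (hs1 : 1 < s) (hs2 : s < 2) (hn : 2 * s < (n : ℝ)) :
    ∀ C₀ > (0:ℝ), ∃ C > (0:ℝ),
      ∀ f : En n → ℝ, Measurable f → (∀ x, 0 ≤ f x) →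
        (∀ r : ℝ, 1 ≤ r →
          ∫⁻ z in Metric.ball (0 : En n) r, ENNReal.ofReal (f z) ≤
            ENNReal.ofReal (C₀ * r ^ ((n : ℝ) - 2 * s))) →
        ∫⁻ x : En n,
            (∫⁻ z : En n, ENNReal.ofReal (f z / ‖x - z‖ ^ ((n : ℝ) - s))) /
              ENNReal.ofReal (1 + ‖x‖ ^ ((n : ℝ) + s)) ≤
          ENNReal.ofReal C := by
  intro C₀ hC₀
  have hn0 : 0 < n := by
    have : (0 : ℝ) < n := by linarith
    exact_mod_cast this
  obtain ⟨K₁, hK₁, hW⟩ := exists_lintegral_riesz_kernel_mul_weight_le (n := n)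
    (a := (n : ℝ) - s) (p := (n : ℝ) + s) hn0 (by linarith) (by linarith) (by linarith)
  obtain ⟨K₂, hK₂, hf⟩ := exists_lintegral_mul_weight_le (n := n)
    (a := (n : ℝ) - s) (b := (n : ℝ) - 2 * s) (by linarith) (by linarith) C₀
  set D := ENNReal.ofReal (2 ^ ((n : ℝ) + s))
  have hD : D ≠ ⊤ := ENNReal.ofReal_ne_top
  have hK : D * (K₁ * K₂) ≠ ⊤ := by finiteness
  refine ⟨(D * (K₁ * K₂)).toReal + 1, by positivity, fun f hfm hf0 hball => ?_⟩
  refine le_trans ?_ ((ENNReal.ofReal_toReal hK).symm.le.trans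
    (ENNReal.ofReal_le_ofReal (by linarith)))
  have hpt (x : En n) :
      (∫⁻ z : En n, ENNReal.ofReal (f z / ‖x - z‖ ^ ((n : ℝ) - s))) /
          ENNReal.ofReal (1 + ‖x‖ ^ ((n : ℝ) + s)) ≤
        D * ∫⁻ z : En n, ENNReal.ofReal (f z) * (ENNReal.ofReal (‖x - z‖ ^ (-((n : ℝ) - s))) *
          ENNReal.ofReal ((1 + ‖x‖) ^ (-((n : ℝ) + s)))) := by
    have hw : (ENNReal.ofReal (1 + ‖x‖ ^ ((n : ℝ) + s)))⁻¹ ≤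
        D * ENNReal.ofReal ((1 + ‖x‖) ^ (-((n : ℝ) + s))) := by
      rw [← ENNReal.ofReal_inv_of_pos (by positivity), ← ENNReal.ofReal_mul (by positivity)]
      apply ENNReal.ofReal_le_ofReal
      rw [Real.rpow_neg (by positivity), ← div_eq_mul_inv, inv_eq_one_div,
        div_le_div_iff₀ (by positivity) (by positivity), one_mul]
      exact one_add_rpow_le (norm_nonneg x) (by linarith)
    simp_rw [← mul_assoc]
    rw [lintegral_mul_const' _ _ ENNReal.ofReal_ne_top, div_eq_mul_inv, mul_left_comm]
    refine mul_le_mul' (lintegral_mono fun z => ?_) hw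
    rw [← ENNReal.ofReal_mul (hf0 z), Real.rpow_neg (norm_nonneg _), div_eq_mul_inv]
  calc _ ≤ ∫⁻ x : En n, _ := lintegral_mono hpt
    _ = D * ∫⁻ z : En n, ENNReal.ofReal (f z) * ∫⁻ x : En n,
          ENNReal.ofReal (‖x - z‖ ^ (-((n : ℝ) - s))) *
            ENNReal.ofReal ((1 + ‖x‖) ^ (-((n : ℝ) + s))) := by
        rw [lintegral_const_mul' _ _ hD, lintegral_lintegral_swap]
        · simp_rw [lintegral_const_mul' _ _ ENNReal.ofReal_ne_top]
        · exact Measurable.aemeasurable (by fun_prop)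
    _ ≤ D * ∫⁻ z : En n, K₁ *
          (ENNReal.ofReal (f z) * ENNReal.ofReal ((1 + ‖z‖) ^ (-((n : ℝ) - s)))) := by
        refine mul_le_mul_right (lintegral_mono fun z => ?_) _
        rw [mul_left_comm]
        exact mul_le_mul_right (hW z) _
    _ ≤ D * (K₁ * K₂) := by
        rw [lintegral_const_mul' _ _ hK₁]
        gcongr
        exact hf f hfm hball
end
end

section
/- Let $1<s<2$ and $2s<n<2\alpha^* s$, where $\alpha^*$ is the largest real root of $X^3-8X+4$. Let $u:\mathbb{R}^n\to\mathbb{R}$ be continuous and suppose: (a) there is $C_0>0$ with $\int_{B_r}e^{u}\,dx\le C_0 r^{n-2s}$ for all $r\ge1$; (b) for every $p\in[1,\alpha_s)$ there is $C(p)$ such that $\int_{B(x,|x|/2)}e^{p\,u(z)}\,dz\le C(p)|x|^{n-2ps}$ for all large $|x|$, where $\alpha_s:=\max\{\frac{n}{n-s}\min\{\frac{n}{2s},\alpha^*\},\ \min\{\frac{n}{2s},\alpha^*\}+\frac12\}$; and (c) there is a constant $c_0\in\mathbb{R}$ with $u(x)=c(n,s)\int_{\mathbb{R}^n}\big(\frac{1}{|x-z|^{n-2s}}-\frac{1}{(1+|z|)^{n-2s}}\big)e^{u(z)}\,dz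 + c_0$ for every $x$, where $c(n,s)=\frac{\Gamma(\frac n2-s)}{4^{s}\pi^{n/2}\Gamma(s)}$ is the Riesz kernel normalization. Then there exists $C>0$ such that $u(x)\le -2s\log|x|+C$ for all sufficiently large $|x|$. -/
open MeasureTheory Metric Filter Set

noncomputable section

/-- The normalization `c(n,s) = Γ(n/2 - s) / (4^s π^{n/2} Γ(s))` for which
`c(n,s) |x|^{2s-n}` is the fundamental solution of `(-Δ)^s` on `ℝ^n`. -/
def cRiesz (n : ℕ) (s : ℝ) : ℝ :=
  Real.Gamma ((n : ℝ) / 2 - s) / ((4:ℝ) ^ s * Real.pi ^ ((n : ℝ) / 2) * Real.Gamma s)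

theorem continuous_integrableOn_ball {n : ℕ} {f : En n → ℝ} (hf : Continuous f) (x : En n) (r : ℝ) :
    IntegrableOn f (ball x r) :=
  (hf.continuousOn.integrableOn_compact (isCompact_closedBall x r)).mono_set ball_subset_closedBall

theorem integrableOn_and_integral_tail_le {n : ℕ} {a C₀ R : ℝ} {f : En n → ℝ}
    (hf : Continuous f) (h0 : ∀ z, 0 ≤ f z) (haa : 0 < a) (hC₀ : 0 ≤ C₀)
    (ha : ∀ r : ℝ, 1 ≤ r → ∫ z in ball (0 : En n) r, f z ≤ C₀ * r ^ a) (hR : 1 ≤ R) :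
    IntegrableOn (fun z => f z * ‖z‖ ^ (-(a + 1))) {z | R ≤ ‖z‖} ∧
      ∫ z in {z : En n | R ≤ ‖z‖}, f z * ‖z‖ ^ (-(a + 1)) ≤ 2 ^ (a + 1) * C₀ / R := by
  have hR0 : 0 < R := by linarith
  set g : En n → ℝ := fun z => f z * ‖z‖ ^ (-(a + 1)) with hg
  have g0 : ∀ z, 0 ≤ g z := fun z => mul_nonneg (h0 z) (by positivity)
  have gm : Measurable g := by
    have := hf.measurable
    fun_prop
  set A : ℕ → Set (En n) := fun k => {z | R * 2 ^ k ≤ ‖z‖ ∧ ‖z‖ < R * 2 ^ (k + 1)} with hA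
  have hcover : {z : En n | R ≤ ‖z‖} ⊆ ⋃ k, A k := by
    intro z hz
    obtain ⟨k, hk1, hk2⟩ := exists_nat_pow_near (x := ‖z‖ / R) (y := 2)
      (by rw [le_div_iff₀ hR0]; simpa using hz) (by norm_num)
    refine mem_iUnion.2 ⟨k, ?_, ?_⟩
    · rw [le_div_iff₀ hR0] at hk1; linarith
    · rw [div_lt_iff₀ hR0] at hk2; linarith
  have hpiece : ∀ k, ∫⁻ z in A k, ENNReal.ofReal (g z) ≤
      ENNReal.ofReal (2 ^ a * C₀ / R * (1 / 2) ^ k) := by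
    intro k
    have hmA : MeasurableSet (A k) := by
      apply MeasurableSet.inter
      · exact measurableSet_le measurable_const measurable_norm
      · exact measurableSet_lt measurable_norm measurable_const
    set ρ : ℝ := R * 2 ^ k with hρ
    have h2k : (1 : ℝ) ≤ 2 ^ k := one_le_pow₀ (by norm_num)
    have hρ1 : 1 ≤ ρ := by nlinarith
    have hρ0 : 0 < ρ := by linarith
    have hIf := continuous_integrableOn_ball hf (0 : En n) (2 * ρ)
    calc ∫⁻ z in A k, ENNReal.ofReal (g z)
        ≤ ∫⁻ z in A k, ENNReal.ofReal (f z * ρ ^ (-(a + 1))) := by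
          refine setLIntegral_mono' hmA fun z hz => ENNReal.ofReal_le_ofReal ?_
          refine mul_le_mul_of_nonneg_left ?_ (h0 z)
          exact Real.rpow_le_rpow_of_nonpos hρ0 hz.1 (by linarith)
      _ ≤ ∫⁻ z in ball (0 : En n) (2 * ρ), ENNReal.ofReal (f z * ρ ^ (-(a + 1))) := by
          refine lintegral_mono_set fun z hz => ?_
          rw [mem_ball_zero_iff]
          have := hz.2
          rw [pow_succ] at this
          linarith
      _ = ENNReal.ofReal (∫ z in ball (0 : En n) (2 * ρ), f z * ρ ^ (-(a + 1))) := by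
          rw [ofReal_integral_eq_lintegral_ofReal (hIf.mul_const _)]
          exact ae_of_all _ fun z => mul_nonneg (h0 z) (by positivity)
      _ ≤ _ := by
          apply ENNReal.ofReal_le_ofReal
          rw [integral_mul_const]
          have h1 := ha (2 * ρ) (by linarith)
          calc (∫ z in ball (0 : En n) (2 * ρ), f z) * ρ ^ (-(a + 1))
              ≤ (C₀ * (2 * ρ) ^ a) * ρ ^ (-(a + 1)) := by gcongr
            _ = 2 ^ a * C₀ * (ρ ^ a * ρ ^ (-(a + 1))) := by
                rw [Real.mul_rpow (by norm_num) hρ0.le]; ring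
            _ = 2 ^ a * C₀ * ρ⁻¹ := by
                rw [← Real.rpow_add hρ0, ← Real.rpow_neg_one]; ring_nf
            _ = _ := by rw [hρ]; rw [one_div, inv_pow]; field_simp
  have hl : ∫⁻ z in {z : En n | R ≤ ‖z‖}, ENNReal.ofReal (g z) ≤
      ENNReal.ofReal (2 ^ (a + 1) * C₀ / R) := by
    calc _ ≤ ∫⁻ z in ⋃ k, A k, ENNReal.ofReal (g z) := lintegral_mono_set hcover
      _ ≤ ∑' k, ∫⁻ z in A k, ENNReal.ofReal (g z) := lintegral_iUnion_le _ _
      _ ≤ ∑' k, ENNReal.ofReal (2 ^ a * C₀ / R * (1 / 2) ^ k) := ENNReal.tsum_le_tsum hpiece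
      _ = ENNReal.ofReal (∑' k, 2 ^ a * C₀ / R * (1 / 2) ^ k) := by
          rw [ENNReal.ofReal_tsum_of_nonneg (fun k => by positivity)]
          exact summable_geometric_two.mul_left _
      _ = _ := by
          rw [tsum_mul_left, tsum_geometric_two, Real.rpow_add_one (by norm_num)]
          ring_nf
  have hint : IntegrableOn g {z : En n | R ≤ ‖z‖} := by
    refine ⟨gm.aestronglyMeasurable, ?_⟩
    rw [hasFiniteIntegral_iff_ofReal (ae_of_all _ g0)]
    exact hl.trans_lt ENNReal.ofReal_lt_top
  refine ⟨hint, ?_⟩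
  rw [← ENNReal.ofReal_le_ofReal_iff (by positivity),
    ofReal_integral_eq_lintegral_ofReal hint (ae_of_all _ g0)]
  exact hl

theorem integrableOn_and_integral_ball_norm_rpow {n : ℕ} (hn : 0 < n) {b ρ : ℝ} (hb : b < n)
    (hρ : 0 < ρ) (x : En n) :
    IntegrableOn (fun z => ‖x - z‖ ^ (-b)) (ball x ρ) ∧
      ∫ z in ball x ρ, ‖x - z‖ ^ (-b) =
        n * volume.real (ball (0 : En n) 1) / (n - b) * ρ ^ (n - b) := by
  have : Nonempty (Fin n) := ⟨⟨0, hn⟩⟩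
  set F : ℝ → ℝ := (Iio ρ).indicator fun t => t ^ (-b) with hF
  have key : (ball x ρ).indicator (fun z => ‖x - z‖ ^ (-b)) = fun z => F ‖x - z‖ := by
    ext z
    simp only [hF, indicator, mem_ball, mem_Iio, dist_comm z x, dist_eq_norm]
  have e1 : EqOn (fun y : ℝ => y ^ (n - 1) • F y)
      ((Ioo 0 ρ).indicator fun y => y ^ ((n : ℝ) - 1 - b)) (Ioi 0) := by
    intro y hy
    have hy : 0 < y := hy
    simp only [hF, indicator, mem_Iio, mem_Ioo, hy, true_and, smul_eq_mul]
    split_ifs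
    · rw [← Real.rpow_natCast, ← Real.rpow_add hy, Nat.cast_sub hn]
      congr 1; push_cast; ring
    · simp
  have hii : IntegrableOn (fun y : ℝ => y ^ ((n : ℝ) - 1 - b)) (Ioo 0 ρ) := by
    rw [intervalIntegral.integrableOn_Ioo_rpow_iff hρ]; linarith
  have hI : Integrable fun z : En n => F ‖z‖ := by
    rw [integrable_fun_norm_addHaar volume, finrank_euclideanSpace_fin,
      integrableOn_congr_fun e1 measurableSet_Ioi, IntegrableOn,
      integrable_indicator_iff measurableSet_Ioo]
    exact hii.mono_measure Measure.restrict_le_self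
  have hI' : Integrable fun z : En n => F ‖x - z‖ := hI.comp_sub_left x
  refine ⟨?_, ?_⟩
  · rw [← integrable_indicator_iff measurableSet_ball, key]; exact hI'
  · rw [← integral_indicator measurableSet_ball, key,
      integral_sub_left_eq_self (fun z => F ‖z‖) volume x, integral_fun_norm_addHaar volume F,
      finrank_euclideanSpace_fin, setIntegral_congr_fun measurableSet_Ioi e1,
      setIntegral_indicator measurableSet_Ioo, Ioi_inter_Ioo, max_self,
      ← integral_Ioc_eq_integral_Ioo, ← intervalIntegral.integral_of_le hρ.le,
      integral_rpow (Or.inl (by linarith)), nsmul_eq_mul, smul_eq_mul,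
      Real.zero_rpow (by linarith)]
    have e2 : (n : ℝ) - 1 - b + 1 = n - b := by ring
    rw [e2]
    ring

theorem integrableOn_and_integral_ball_mul_norm_rpow_le {n : ℕ} (hn : 0 < n) {a p q D r : ℝ}
    (hpq : p.HolderConjugate q) (haq : a * q < n) {f : En n → ℝ} (hf : Continuous f)
    (h0 : ∀ z, 0 ≤ f z) (hr : 0 < r) (x : En n)
    (hfp : ∫ z in ball x (r / 2), f z ^ p ≤ D * r ^ (n - p * (n - a))) :
    IntegrableOn (fun z => f z * ‖x - z‖ ^ (-a)) (ball x (r / 2)) ∧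
      ∫ z in ball x (r / 2), f z * ‖x - z‖ ^ (-a) ≤ D / p +
        n * volume.real (ball (0 : En n) 1) / (n - a * q) * (1 / 2) ^ (n - a * q) / q := by
  have hp0 := hpq.pos
  have hq0 := hpq.symm.pos
  obtain ⟨hI, hE⟩ := integrableOn_and_integral_ball_norm_rpow hn haq (half_pos hr) x
  have hfpI : IntegrableOn (fun z => f z ^ p) (ball x (r / 2)) :=
    continuous_integrableOn_ball (hf.rpow_const fun _ => Or.inr hp0.le) x _
  set G : En n → ℝ := fun z => r ^ (p * (n - a) - n) / p * f z ^ p +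
    r ^ (a * q - n) / q * ‖x - z‖ ^ (-(a * q)) with hG
  have hGI : IntegrableOn G (ball x (r / 2)) := (hfpI.const_mul _).add (hI.const_mul _)
  have hle : ∀ z, f z * ‖x - z‖ ^ (-a) ≤ G z := by
    intro z
    have hN := norm_nonneg (x - z)
    have hy := Real.young_inequality_of_nonneg (a := r ^ ((n : ℝ) - a) * f z)
      (b := r ^ a * ‖x - z‖ ^ (-a)) (mul_nonneg (by positivity) (h0 z)) (by positivity) hpq
    rw [Real.mul_rpow (by positivity) (h0 z), Real.mul_rpow (by positivity) (by positivity),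
      ← Real.rpow_mul hr.le, ← Real.rpow_mul hr.le, ← Real.rpow_mul hN] at hy
    have h1 : r ^ ((n : ℝ) - a) * f z * (r ^ a * ‖x - z‖ ^ (-a)) =
        r ^ (n : ℝ) * (f z * ‖x - z‖ ^ (-a)) := by
      rw [show (n : ℝ) = n - a + a by ring, Real.rpow_add hr]; ring_nf
    have h2 : r ^ (n : ℝ) * G z = r ^ ((n - a) * p) * f z ^ p / p +
        r ^ (a * q) * ‖x - z‖ ^ (-a * q) / q := by
      simp only [hG]
      rw [Real.rpow_sub hr, Real.rpow_sub hr, mul_comm p, neg_mul]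
      field_simp
    rw [h1, ← h2] at hy
    exact le_of_mul_le_mul_left hy (by positivity)
  have hm : Measurable fun z => f z * ‖x - z‖ ^ (-a) := by
    have := hf.measurable
    fun_prop
  have hint : IntegrableOn (fun z => f z * ‖x - z‖ ^ (-a)) (ball x (r / 2)) := by
    refine hGI.mono' hm.aestronglyMeasurable (ae_of_all _ fun z => ?_)
    rw [Real.norm_of_nonneg (mul_nonneg (h0 z) (by positivity))]
    exact hle z
  refine ⟨hint, (setIntegral_mono hint hGI hle).trans ?_⟩
  rw [integral_add (hfpI.const_mul _) (hI.const_mul _), integral_const_mul, integral_const_mul, hE]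
  have h3 : r ^ (p * (n - a) - n) / p * (∫ z in ball x (r / 2), f z ^ p) ≤ D / p := by
    calc _ ≤ r ^ (p * (n - a) - n) / p * (D * r ^ (n - p * (n - a))) := by gcongr
      _ = D / p * (r ^ (p * (n - a) - n) * r ^ (n - p * (n - a))) := by ring
      _ = D / p := by rw [← Real.rpow_add hr]; simp
  have h4 : r ^ (a * q - n) / q * (n * volume.real (ball (0 : En n) 1) / (n - a * q) *
      (r / 2) ^ (n - a * q)) =
      n * volume.real (ball (0 : En n) 1) / (n - a * q) * (1 / 2) ^ (n - a * q) / q := by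
    rw [show r / 2 = r * (1 / 2) by ring, Real.mul_rpow hr.le (by norm_num)]
    have : r ^ (a * q - n) * r ^ (n - a * q) = 1 := by rw [← Real.rpow_add hr]; simp
    linear_combination (n * volume.real (ball (0 : En n) 1) / (n - a * q) *
      (1 / 2) ^ (n - a * q) / q) * this
  linarith

theorem abs_rpow_neg_sub_rpow_neg_le {a m t v : ℝ} (ha : 0 < a) (hm : 0 < m) (ht : m ≤ t)
    (hv : m ≤ v) : |t ^ (-a) - v ^ (-a)| ≤ a * m ^ (-(a + 1)) * |t - v| := by
  have h := Convex.norm_image_sub_le_of_norm_deriv_le (𝕜 := ℝ) (f := fun t : ℝ => t ^ (-a))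
    (s := Ici m) (C := a * m ^ (-(a + 1))) (x := v) (y := t) ?_ ?_ (convex_Ici m) hv ht
  · simpa only [Real.norm_eq_abs] using h
  · intro y hy
    exact Real.differentiableAt_rpow_const_of_ne _ (hm.trans_le hy).ne'
  · intro y hy
    have hy0 : 0 < y := hm.trans_le hy
    rw [Real.deriv_rpow_const, norm_mul, Real.norm_eq_abs, Real.norm_eq_abs, abs_neg,
      abs_of_pos ha, abs_of_nonneg (by positivity), show -a - 1 = -(a + 1) by ring]
    gcongr ?_ * ?_
    exact Real.rpow_le_rpow_of_nonpos hm hy (by linarith)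

theorem abs_kernel_le {n : ℕ} {a : ℝ} (ha : 0 < a) (x z : En n) (hx : 1 ≤ ‖x‖) :
    |‖x - z‖ ^ (-a) - (1 + ‖z‖) ^ (-a) +
        (ball (0 : En n) ‖x‖).indicator (fun z => (1 + ‖z‖) ^ (-a)) z| ≤
      (ball x (‖x‖ / 2)).indicator (fun z => ‖x - z‖ ^ (-a)) z +
      (ball (0 : En n) (2 * ‖x‖)).indicator (fun _ => (2 ^ a + 1) * ‖x‖ ^ (-a)) z +
      {z : En n | 2 * ‖x‖ ≤ ‖z‖}.indicator
        (fun z => a * 2 ^ (a + 2) * ‖x‖ * ‖z‖ ^ (-(a + 1))) z := by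
  have hx0 : 0 < ‖x‖ := by linarith
  have hz0 := norm_nonneg z
  have hpos : 0 ≤ ‖x - z‖ ^ (-a) := by positivity
  have hfar : ‖x‖ / 2 ≤ ‖x - z‖ → ‖x - z‖ ^ (-a) ≤ 2 ^ a * ‖x‖ ^ (-a) := fun h => by
    refine (Real.rpow_le_rpow_of_nonpos (half_pos hx0) h (by linarith)).trans_eq ?_
    rw [Real.div_rpow hx0.le (by norm_num), Real.rpow_neg (by norm_num : (0 : ℝ) ≤ 2)]
    field_simp
  have hB : z ∈ ball x (‖x‖ / 2) ↔ ‖x - z‖ < ‖x‖ / 2 := by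
    rw [mem_ball, dist_comm, dist_eq_norm]
  have h2a : (0 : ℝ) < 2 ^ a := by positivity
  have hxa : 0 < ‖x‖ ^ (-a) := by positivity
  have t1 : 0 ≤ {z : En n | 2 * ‖x‖ ≤ ‖z‖}.indicator
        (fun z => a * 2 ^ (a + 2) * ‖x‖ * ‖z‖ ^ (-(a + 1))) z :=
    indicator_nonneg (fun z _ => by positivity) z
  have t2 : 0 ≤ (ball x (‖x‖ / 2)).indicator (fun z => ‖x - z‖ ^ (-a)) z :=
    indicator_nonneg (fun z _ => by positivity) z
  have hnear : ‖x - z‖ ^ (-a) ≤ (ball x (‖x‖ / 2)).indicator (fun z => ‖x - z‖ ^ (-a)) z +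
      2 ^ a * ‖x‖ ^ (-a) := by
    by_cases h : ‖x - z‖ < ‖x‖ / 2
    · rw [indicator_of_mem (hB.2 h)]
      have : 0 < 2 ^ a * ‖x‖ ^ (-a) := by positivity
      linarith
    · have := hfar (not_lt.1 h)
      linarith
  by_cases h2 : ‖z‖ < 2 * ‖x‖
  · rw [indicator_of_mem (s := ball (0 : En n) (2 * ‖x‖)) (by simpa using h2)]
    by_cases h1 : ‖z‖ < ‖x‖
    · rw [indicator_of_mem (s := ball (0 : En n) ‖x‖) (by simpa using h1), sub_add_cancel,
        abs_of_nonneg hpos]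
      linarith
    · rw [indicator_of_notMem (s := ball (0 : En n) ‖x‖) (by simpa using h1), add_zero]
      have h3 : (1 + ‖z‖) ^ (-a) ≤ ‖x‖ ^ (-a) :=
        Real.rpow_le_rpow_of_nonpos hx0 (by linarith) (by linarith)
      have h4 : 0 ≤ (1 + ‖z‖) ^ (-a) := by positivity
      rw [abs_le]
      constructor <;> nlinarith
  · have h2' : 2 * ‖x‖ ≤ ‖z‖ := not_lt.1 h2
    have h1 : ¬ ‖z‖ < ‖x‖ := by linarith
    rw [indicator_of_notMem (s := ball (0 : En n) ‖x‖) (by simpa using h1), add_zero,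
      indicator_of_notMem (s := ball (0 : En n) (2 * ‖x‖)) (by simpa using h2'), add_zero,
      indicator_of_mem (s := {z : En n | 2 * ‖x‖ ≤ ‖z‖}) h2']
    have hzx : ‖z‖ - ‖x‖ ≤ ‖x - z‖ := by rw [norm_sub_rev]; exact norm_sub_norm_le z x
    have hzx' : ‖x - z‖ ≤ ‖x‖ + ‖z‖ := norm_sub_le x z
    have h3 := abs_rpow_neg_sub_rpow_neg_le ha (m := ‖z‖ / 2) (t := ‖x - z‖) (v := 1 + ‖z‖)
      (by linarith) (by linarith) (by linarith)
    have h4 : |‖x - z‖ - (1 + ‖z‖)| ≤ 2 * ‖x‖ := by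
      rw [abs_le]; constructor <;> linarith
    have h5 : a * (‖z‖ / 2) ^ (-(a + 1)) * |‖x - z‖ - (1 + ‖z‖)| ≤
        a * (‖z‖ / 2) ^ (-(a + 1)) * (2 * ‖x‖) := by gcongr
    have h6 : a * (‖z‖ / 2) ^ (-(a + 1)) * (2 * ‖x‖) =
        a * 2 ^ (a + 2) * ‖x‖ * ‖z‖ ^ (-(a + 1)) := by
      rw [Real.div_rpow hz0 (by norm_num), Real.rpow_neg (by norm_num : (0 : ℝ) ≤ 2),
        show a + 2 = a + 1 + 1 by ring, Real.rpow_add_one (by norm_num) (a + 1)]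
      field_simp
    linarith

theorem exists_abs_integral_kernel_add_le {n : ℕ} (hn : 0 < n) {a p q C₀ : ℝ} (ha : 0 < a)
    (hpq : p.HolderConjugate q) (haq : a * q < n) {f : En n → ℝ} (hf : Continuous f)
    (h0 : ∀ z, 0 ≤ f z) (hC₀ : 0 ≤ C₀)
    (hball : ∀ r : ℝ, 1 ≤ r → ∫ z in ball (0 : En n) r, f z ≤ C₀ * r ^ a) (D : ℝ) :
    ∃ E : ℝ, ∀ x : En n, 1 ≤ ‖x‖ →
      ∫ z in ball x (‖x‖ / 2), f z ^ p ≤ D * ‖x‖ ^ (n - p * (n - a)) →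
      |(∫ z, (‖x - z‖ ^ (-a) - (1 + ‖z‖) ^ (-a)) * f z) +
        ∫ z in ball (0 : En n) ‖x‖, (1 + ‖z‖) ^ (-a) * f z| ≤ E := by
  refine ⟨D / p + n * volume.real (ball (0 : En n) 1) / (n - a * q) * (1 / 2) ^ (n - a * q) / q +
    (2 ^ a + 1) * (C₀ * 2 ^ a) + a * 2 ^ (a + 2) * (2 ^ (a + 1) * C₀ / 2), fun x hx hD => ?_⟩
  have hx0 : 0 < ‖x‖ := by linarith
  obtain ⟨hI1, hE1⟩ :=
    integrableOn_and_integral_ball_mul_norm_rpow_le hn hpq haq hf h0 hx0 x hD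
  obtain ⟨hI3, hE3⟩ := integrableOn_and_integral_tail_le hf h0 ha hC₀ hball
    (show 1 ≤ 2 * ‖x‖ by linarith)
  have hI2 := continuous_integrableOn_ball hf (0 : En n) (2 * ‖x‖)
  have hE2 := hball (2 * ‖x‖) (by linarith)
  have hmT : MeasurableSet {z : En n | 2 * ‖x‖ ≤ ‖z‖} :=
    measurableSet_le measurable_const measurable_norm
  set c₂ : ℝ := (2 ^ a + 1) * ‖x‖ ^ (-a) with hc₂
  set c₃ : ℝ := a * 2 ^ (a + 2) * ‖x‖ with hc₃
  set G₁ : En n → ℝ := (ball x (‖x‖ / 2)).indicator fun z => f z * ‖x - z‖ ^ (-a) with hG₁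
  set G₂ : En n → ℝ := (ball (0 : En n) (2 * ‖x‖)).indicator fun z => f z with hG₂
  set G₃ : En n → ℝ :=
    {z : En n | 2 * ‖x‖ ≤ ‖z‖}.indicator fun z => f z * ‖z‖ ^ (-(a + 1)) with hG₃
  have J1 : Integrable G₁ := hI1.integrable_indicator measurableSet_ball
  have J2 : Integrable G₂ := hI2.integrable_indicator measurableSet_ball
  have J3 : Integrable G₃ := hI3.integrable_indicator hmT
  have hφI : IntegrableOn (fun z => (1 + ‖z‖) ^ (-a) * f z) (ball (0 : En n) ‖x‖) := by
    refine continuous_integrableOn_ball (Continuous.mul ?_ hf) _ _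
    exact (continuous_const.add continuous_norm).rpow_const fun z =>
      Or.inl (ne_of_gt (show 0 < 1 + ‖z‖ by positivity))
  set φ : En n → ℝ := (ball (0 : En n) ‖x‖).indicator fun z => (1 + ‖z‖) ^ (-a) * f z with hφ
  have Jφ : Integrable φ := hφI.integrable_indicator measurableSet_ball
  set K : En n → ℝ := fun z => (‖x - z‖ ^ (-a) - (1 + ‖z‖) ^ (-a)) * f z with hK
  have hKm : Measurable K := by
    have := hf.measurable
    fun_prop
  have JG : Integrable fun z => G₁ z + c₂ * G₂ z + c₃ * G₃ z :=
    (J1.add (J2.const_mul _)).add (J3.const_mul _)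
  have hbound : ∀ z, ‖K z + φ z‖ ≤ G₁ z + c₂ * G₂ z + c₃ * G₃ z := by
    intro z
    have h := mul_le_mul_of_nonneg_right (abs_kernel_le ha x z hx) (h0 z)
    rw [← abs_of_nonneg (h0 z), ← abs_mul, abs_of_nonneg (h0 z)] at h
    rw [Real.norm_eq_abs]
    refine (le_of_eq ?_).trans (h.trans_eq ?_)
    · congr 1
      simp only [hK, hφ, indicator]; split_ifs <;> ring
    · simp only [hG₁, hG₂, hG₃, indicator]; split_ifs <;> ring
  have JKφ : Integrable fun z => K z + φ z :=
    JG.mono' (hKm.aestronglyMeasurable.add Jφ.aestronglyMeasurable) (ae_of_all _ hbound)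
  have JK : Integrable K := by
    have := JKφ.sub Jφ
    refine this.congr (ae_of_all _ fun z => ?_)
    simp
  rw [← integral_indicator measurableSet_ball, ← integral_add JK Jφ, ← Real.norm_eq_abs]
  refine (norm_integral_le_of_norm_le JG (ae_of_all _ hbound)).trans ?_
  have hsplit : ∫ z, (G₁ z + c₂ * G₂ z + c₃ * G₃ z) =
      (∫ z, (G₁ z + c₂ * G₂ z)) + ∫ z, c₃ * G₃ z :=
    integral_add (J1.add (J2.const_mul _)) (J3.const_mul _)
  rw [hsplit, integral_add J1 (J2.const_mul _),
    integral_const_mul, integral_const_mul, hG₁, hG₂, hG₃, integral_indicator measurableSet_ball,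
    integral_indicator measurableSet_ball, integral_indicator hmT]
  have h2 : c₂ * ∫ z in ball (0 : En n) (2 * ‖x‖), f z ≤ (2 ^ a + 1) * (C₀ * 2 ^ a) := by
    calc _ ≤ c₂ * (C₀ * (2 * ‖x‖) ^ a) := by gcongr
      _ = (2 ^ a + 1) * (C₀ * 2 ^ a) := by
        rw [Real.mul_rpow (by norm_num) hx0.le, hc₂, Real.rpow_neg hx0.le]
        field_simp
  have h3 : c₃ * ∫ z in {z : En n | 2 * ‖x‖ ≤ ‖z‖}, f z * ‖z‖ ^ (-(a + 1)) ≤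
      a * 2 ^ (a + 2) * (2 ^ (a + 1) * C₀ / 2) := by
    calc _ ≤ c₃ * (2 ^ (a + 1) * C₀ / (2 * ‖x‖)) := by gcongr
      _ = _ := by rw [hc₃]; field_simp
  linarith

theorem exists_mul_log_le_of_doubling {H : ℝ → ℝ} {κ σ R : ℝ} (hκ : 0 < κ) (hσ : 0 < σ)
    (hR : 1 ≤ R) (hmono : ∀ r t, R ≤ r → r ≤ t → H r ≤ H t)
    (hH : ∀ r, R ≤ r → H r + κ * r ^ σ * Real.exp (-H r) ≤ H (2 * r)) :
    ∃ C > 0, ∀ r, R ≤ r → σ * Real.log r ≤ H r + C := by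
  have hR0 : 0 < R := by linarith
  set w : ℕ → ℝ := fun k => σ * Real.log (R * 2 ^ k) - H (R * 2 ^ k) with hw
  set B : ℝ := max (w 0) (Real.log (σ * Real.log 2 / κ) + σ * Real.log 2) with hB
  have hl2 : 0 < Real.log 2 := Real.log_pos (by norm_num)
  have hstep : ∀ k, w k ≤ B := by
    intro k
    induction k with
    | zero => exact le_max_left _ _
    | succ k ih =>
      have h2k : (1 : ℝ) ≤ 2 ^ k := one_le_pow₀ (by norm_num)
      have hρ : R ≤ R * 2 ^ k := by nlinarith
      have hρ0 : 0 < R * 2 ^ k := by positivity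
      have h := hH _ hρ
      have e1 : R * 2 ^ (k + 1) = 2 * (R * 2 ^ k) := by ring
      have e2 : (R * 2 ^ k) ^ σ * Real.exp (-H (R * 2 ^ k)) = Real.exp (w k) := by
        rw [Real.rpow_def_of_pos hρ0, ← Real.exp_add]
        simp only [hw]; ring_nf
      have h1 : w (k + 1) ≤ w k + σ * Real.log 2 - κ * Real.exp (w k) := by
        rw [← e2]
        simp only [hw]
        rw [e1, Real.log_mul (by norm_num) hρ0.ne']
        linarith
      rcases le_total (w k) (Real.log (σ * Real.log 2 / κ)) with h3 | h3
      · have := Real.exp_pos (w k)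
        have : 0 < κ * Real.exp (w k) := by positivity
        exact le_max_of_le_right (by linarith)
      · rw [Real.log_le_iff_le_exp (by positivity), div_le_iff₀ hκ] at h3
        linarith
  refine ⟨|B| + σ * Real.log 2, by positivity, fun r hr => ?_⟩
  obtain ⟨k, hk1, hk2⟩ := exists_nat_pow_near (x := r / R) (y := 2)
      (by rw [le_div_iff₀ hR0]; simpa using hr) (by norm_num)
  rw [le_div_iff₀ hR0, mul_comm] at hk1
  rw [div_lt_iff₀ hR0] at hk2
  have h2k : (1 : ℝ) ≤ 2 ^ k := one_le_pow₀ (by norm_num)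
  have hρ : R ≤ R * 2 ^ k := by nlinarith
  have h1 := hmono _ _ hρ hk1
  have h2 : Real.log r ≤ Real.log 2 + Real.log (R * 2 ^ k) := by
    rw [← Real.log_mul (by norm_num) (by positivity)]
    exact Real.log_le_log (by linarith) (by rw [pow_succ] at hk2; linarith)
  have h3 := hstep k
  simp only [hw] at h3
  have h4 := le_abs_self B
  nlinarith

theorem cRiesz_pos {n : ℕ} {s : ℝ} (hs : 0 < s) (hn : 2 * s < (n : ℝ)) : 0 < cRiesz n s := by
  have h1 := Real.Gamma_pos_of_pos hs
  have h2 := Real.Gamma_pos_of_pos (show 0 < (n : ℝ) / 2 - s by linarith)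
  have := Real.pi_pos
  unfold cRiesz
  positivity

theorem volume_real_ball_diff_ball {n : ℕ} {r : ℝ} (hr : 0 < r) :
    volume.real (ball (0 : En n) (2 * r) \ ball (0 : En n) r) =
      (2 ^ n - 1) * volume.real (ball (0 : En n) 1) * r ^ (n : ℝ) := by
  have hvol : ∀ t : ℝ, 0 < t → volume.real (ball (0 : En n) t) =
      t ^ n * volume.real (ball (0 : En n) 1) := fun t ht => by
    have h := Measure.addHaar_ball_mul_of_pos (volume : Measure (En n)) 0 ht 1
    rw [mul_one, finrank_euclideanSpace_fin] at h
    rw [measureReal_def, h, ENNReal.toReal_mul, ENNReal.toReal_ofReal (by positivity),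
      measureReal_def]
  rw [measureReal_sdiff (ball_subset_ball (by linarith)) measurableSet_ball, hvol _ hr,
    hvol _ (by linarith), mul_pow, Real.rpow_natCast]
  ring

theorem weighted_integral_doubling {n : ℕ} (hn : 0 < n) {a c R E C₀ : ℝ} {u : En n → ℝ}
    {H : ℝ → ℝ} (hu : Continuous u) (ha : 0 < a) (hc : 0 < c) (hR : 1 ≤ R)
    (hball : ∀ r : ℝ, 1 ≤ r → ∫ z in ball (0 : En n) r, Real.exp (u z) ≤ C₀ * r ^ a)
    (hHdef : ∀ r, H r = c * ∫ z in ball (0 : En n) r, (1 + ‖z‖) ^ (-a) * Real.exp (u z))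
    (hlow : ∀ z, R ≤ ‖z‖ → -H ‖z‖ - E ≤ u z) :
    (∀ r t, R ≤ r → r ≤ t → H r ≤ H t) ∧
      ∃ κ > 0, ∀ r, R ≤ r → H r + κ * r ^ (n - a) * Real.exp (-H r) ≤ H (2 * r) := by
  have : Nonempty (Fin n) := ⟨⟨0, hn⟩⟩
  set φ : En n → ℝ := fun z => (1 + ‖z‖) ^ (-a) * Real.exp (u z) with hφ
  have hφc : Continuous φ := by
    refine Continuous.mul ?_ (Real.continuous_exp.comp hu)
    exact (continuous_const.add continuous_norm).rpow_const fun z =>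
      Or.inl (ne_of_gt (show 0 < 1 + ‖z‖ by positivity))
  have hφ0 : ∀ z, 0 ≤ φ z := fun z => by positivity
  have hmono : ∀ r t, R ≤ r → r ≤ t → H r ≤ H t := by
    intro r t _ hrt
    rw [hHdef, hHdef]
    refine mul_le_mul_of_nonneg_left ?_ hc.le
    exact setIntegral_mono_set (continuous_integrableOn_ball hφc 0 t) (ae_of_all _ hφ0)
      (ball_subset_ball hrt).eventuallyLE
  have hω : 0 < volume.real (ball (0 : En n) 1) :=
    ENNReal.toReal_pos (measure_ball_pos _ _ one_pos).ne' measure_ball_lt_top.ne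
  have h2n : (1 : ℝ) < 2 ^ n := one_lt_pow₀ (by norm_num) hn.ne'
  refine ⟨hmono, c * 3 ^ (-a) * Real.exp (-(c * (C₀ * 2 ^ a)) - E) *
    ((2 ^ n - 1) * volume.real (ball (0 : En n) 1)), ?_, fun r hr => ?_⟩
  · have : (0 : ℝ) < 2 ^ n - 1 := by linarith
    positivity
  have hr1 : 1 ≤ r := hR.trans hr
  have hr0 : 0 < r := by linarith
  set A : Set (En n) := ball 0 (2 * r) \ ball 0 r with hA
  have hAm : MeasurableSet A := measurableSet_ball.diff measurableSet_ball
  have hsub : ball (0 : En n) r ⊆ ball 0 (2 * r) := ball_subset_ball (by linarith)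
  have hAI : IntegrableOn φ A := (continuous_integrableOn_ball hφc 0 (2 * r)).mono_set sdiff_subset
  have hAnorm : ∀ z ∈ A, r ≤ ‖z‖ ∧ ‖z‖ < 2 * r := fun z hz => by
    simpa [hA, and_comm] using hz
  have hHsplit : H (2 * r) = H r + c * ∫ z in A, φ z := by
    rw [hHdef, hHdef, ← mul_add, ← setIntegral_union disjoint_sdiff_right hAm
      (continuous_integrableOn_ball hφc 0 r) hAI, union_sdiff_cancel hsub]
  have hupper : ∫ z in A, φ z ≤ C₀ * 2 ^ a := by
    have hexp := continuous_integrableOn_ball (Real.continuous_exp.comp hu) (0 : En n) (2 * r)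
    calc ∫ z in A, φ z ≤ ∫ z in A, r ^ (-a) * Real.exp (u z) := by
          refine setIntegral_mono_on hAI ((hexp.mono_set sdiff_subset).const_mul _) hAm fun z hz => ?_
          refine mul_le_mul_of_nonneg_right ?_ (Real.exp_pos _).le
          exact Real.rpow_le_rpow_of_nonpos hr0 (by linarith [(hAnorm z hz).1]) (by linarith)
      _ = r ^ (-a) * ∫ z in A, Real.exp (u z) := integral_const_mul _ _
      _ ≤ r ^ (-a) * ∫ z in ball (0 : En n) (2 * r), Real.exp (u z) := by
          refine mul_le_mul_of_nonneg_left ?_ (by positivity)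
          exact setIntegral_mono_set hexp (ae_of_all _ fun z => (Real.exp_pos _).le)
            (sdiff_subset.eventuallyLE)
      _ ≤ r ^ (-a) * (C₀ * (2 * r) ^ a) := by
          gcongr
          exact hball _ (by linarith)
      _ = C₀ * 2 ^ a := by
          rw [Real.mul_rpow (by norm_num) hr0.le, Real.rpow_neg hr0.le]
          field_simp
  have hH2 : H (2 * r) ≤ H r + c * (C₀ * 2 ^ a) := by
    rw [hHsplit]
    gcongr
  have hlower : ∀ z ∈ A, (3 * r) ^ (-a) * Real.exp (-H r - c * (C₀ * 2 ^ a) - E) ≤ φ z := by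
    intro z hz
    obtain ⟨hz1, hz2⟩ := hAnorm z hz
    have h1 := hlow z (hr.trans hz1)
    have h2 := hmono _ _ (hr.trans hz1) hz2.le
    have hz0 := norm_nonneg z
    refine mul_le_mul ?_ (Real.exp_le_exp.2 (by linarith)) (Real.exp_pos _).le (by positivity)
    exact Real.rpow_le_rpow_of_nonpos (by positivity) (by linarith) (by linarith)
  have hge := setIntegral_ge_of_const_le_real hAm
    ((measure_mono sdiff_subset).trans_lt measure_ball_lt_top).ne hlower hAI
  rw [hA, volume_real_ball_diff_ball hr0, ← hA] at hge
  rw [hHsplit]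
  refine add_le_add le_rfl ((le_of_eq ?_).trans (mul_le_mul_of_nonneg_left hge hc.le))
  rw [Real.mul_rpow (by norm_num) hr0.le,
    show -H r - c * (C₀ * 2 ^ a) - E = (-(c * (C₀ * 2 ^ a)) - E) + -H r by ring, Real.exp_add,
    show (n : ℝ) - a = n + -a by ring, Real.rpow_add hr0]
  ring

/-- (Lemma 4.9 of the paper; upper bound on `u`.) Let `1 < s < 2` and
`2s < n < 2α*s`, with `α*` the largest real root of `X³ - 8X + 4`.  Let `u` be continuous
with (a) `∫_{B_r} e^u ≤ C₀ r^{n-2s}` for all `r ≥ 1`, (b) for every `p ∈ [1, α_s)`,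
`∫_{B(x,|x|/2)} e^{pu} ≤ C(p) |x|^{n-2ps}` for all large `|x|`, and (c) the representation
`u(x) = c(n,s) ∫ (|x-z|^{2s-n} - (1+|z|)^{2s-n}) e^{u(z)} dz + c₀`.  Then there is `C > 0`
with `u(x) ≤ -2s log|x| + C` for all sufficiently large `|x|`. -/
theorem pointwise_upper_bound
    (n : ℕ) (s : ℝ) (hs1 : 1 < s) (hs2 : s < 2)
    (αst : ℝ) (hr1 : αst ^ 3 - 8 * αst + 4 = 0)
    (hmax : ∀ x : ℝ, x ^ 3 - 8 * x + 4 = 0 → x ≤ αst)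
    (hn1 : 2 * s < (n : ℝ)) (hn2 : (n : ℝ) < 2 * αst * s)
    (u : En n → ℝ) (hu : Continuous u)
    (C₀ : ℝ) (hC₀ : 0 < C₀)
    (ha : ∀ r : ℝ, 1 ≤ r →
      ∫ x in Metric.ball (0 : En n) r, Real.exp (u x) ≤ C₀ * r ^ ((n : ℝ) - 2 * s))
    (hb : ∀ p : ℝ, 1 ≤ p →
      p < max (((n : ℝ) / ((n : ℝ) - s)) * min ((n : ℝ) / (2 * s)) αst)
          (min ((n : ℝ) / (2 * s)) αst + 1/2) →
      ∃ C > (0:ℝ), ∃ M : ℝ, ∀ x : En n, M ≤ ‖x‖ →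
        ∫ z in Metric.ball x (‖x‖ / 2), Real.exp (p * u z) ≤ C * ‖x‖ ^ ((n : ℝ) - 2 * p * s))
    (c₀ : ℝ)
    (hc : ∀ x : En n, u x = cRiesz n s *
        (∫ z : En n,
          (1 / ‖x - z‖ ^ ((n : ℝ) - 2 * s) - 1 / (1 + ‖z‖) ^ ((n : ℝ) - 2 * s)) *
            Real.exp (u z)) + c₀) :
    ∃ C > (0:ℝ), ∃ M : ℝ, ∀ x : En n, M ≤ ‖x‖ →
      u x ≤ -(2 * s) * Real.log ‖x‖ + C := by
  have hn0 : 0 < n := by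
    have : (0 : ℝ) < n := by linarith
    exact_mod_cast this
  have hs0 : 0 < s := by linarith
  have hmin : min ((n : ℝ) / (2 * s)) αst = n / (2 * s) := by
    rw [min_eq_left]
    rw [div_le_iff₀ (by linarith)]
    linarith
  have hquot : 1 < (n : ℝ) / (2 * s) := by rwa [lt_div_iff₀ (by linarith), one_mul]
  set p : ℝ := n / (2 * s) + 1 / 4 with hp
  have hp1 : 1 < p := by linarith
  have hps : n < 2 * s * p := by
    rw [hp, mul_add, mul_div_cancel₀ _ (by positivity)]
    linarith
  obtain ⟨D, -, M, hD⟩ := hb p hp1.le (by rw [hmin]; exact lt_max_of_lt_right (by linarith))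
  have hpq : p.HolderConjugate p.conjExponent := Real.HolderConjugate.conjExponent hp1
  set a : ℝ := n - 2 * s with ha_def
  have ha0 : 0 < a := by linarith
  have haq : a * p.conjExponent < n := by
    rw [Real.conjExponent, mul_div_assoc', div_lt_iff₀ (by linarith)]
    nlinarith
  have hexp : Continuous fun z => Real.exp (u z) := Real.continuous_exp.comp hu
  obtain ⟨E, hE⟩ := exists_abs_integral_kernel_add_le hn0 ha0 hpq haq hexp
    (fun z => (Real.exp_pos _).le) hC₀.le ha D
  set c := cRiesz n s with hc_def
  have hc0 : 0 < c := cRiesz_pos hs0 hn1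
  set H : ℝ → ℝ := fun r => c * ∫ z in ball (0 : En n) r, (1 + ‖z‖) ^ (-a) * Real.exp (u z)
    with hH
  set R : ℝ := max 1 M with hR
  have hasymp : ∀ x : En n, R ≤ ‖x‖ → |u x + H ‖x‖| ≤ c * E + |c₀| := by
    intro x hx
    have h := hE x ((le_max_left _ _).trans hx) ?_
    · have hK : ∫ z : En n, (1 / ‖x - z‖ ^ a - 1 / (1 + ‖z‖) ^ a) * Real.exp (u z) =
          ∫ z : En n, (‖x - z‖ ^ (-a) - (1 + ‖z‖) ^ (-a)) * Real.exp (u z) := by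
        refine integral_congr_ae (ae_of_all _ fun z => ?_)
        have hz := norm_nonneg z
        simp only [one_div]
        rw [Real.rpow_neg (norm_nonneg _), Real.rpow_neg (by positivity)]
      rw [hc x, hK, show ∀ A B : ℝ, c * A + c₀ + c * B = c * (A + B) + c₀ by intros; ring]
      refine (abs_add_le _ _).trans ?_
      rw [abs_mul, abs_of_pos hc0]
      gcongr
    · convert hD x ((le_max_right _ _).trans hx) using 2
      · simp_rw [mul_comm p, Real.exp_mul]
      · rw [ha_def]; ring_nf
  obtain ⟨hmono, κ, hκ, hdouble⟩ := weighted_integral_doubling hn0 hu ha0 hc0 (le_max_left 1 M)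
    ha (H := H) (fun _ => rfl) (E := c * E + |c₀|)
    fun z hz => by linarith [(abs_le.1 (hasymp z hz)).1]
  obtain ⟨C, hC, hlog⟩ := exists_mul_log_le_of_doubling hκ (show 0 < (n : ℝ) - a by linarith)
    (le_max_left 1 M) hmono hdouble
  refine ⟨C + |(c * E + |c₀|)|, by positivity, R, fun x hx => ?_⟩
  have h1 := (abs_le.1 (hasymp x hx)).2
  have h2 := hlog _ hx
  have h3 := le_abs_self (c * E + |c₀|)
  rw [show (n : ℝ) - a = 2 * s by rw [ha_def]; ring] at h2
  linarith
end
end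

section
/- Let $1<s<2$ and $n>2s$, and let $C_0>0$. There exists $C=C(n,s,C_0)>0$ with the following property. Let $f:\mathbb{R}^n\to[0,\infty)$ be measurable with $\int_{B_r}f(z)\,dz\le C_0 r^{n-2s}$ for every $r\ge1$, let $c_0\in\mathbb{R}$, and set $w(x)=c(n,s)\int_{\mathbb{R}^n}\big(\frac{1}{|x-z|^{n-2s}}-\frac{1}{(1+|z|)^{n-2s}}\big)f(z)\,dz$ (with $c(n,s)=\frac{\Gamma(\frac n2-s)}{4^{s}\pi^{n/2}\Gamma(s)}$), $u(x)=w(x)+c_0$, and let $u_e(x,y)=\int_{\mathbb{R}^n}P_s(x-z,y)\,u(z)\,dz$ be its extension to the upper half-space, where $P_s(x,y)=\kappa_{n,s}\,y^{2s}(|x|^2+y^2)^{-\frac{n}{2}-s}$ and $\kappa_{n,s}=\frac{\Gamma(\frac n2+s)}{\Gamma(s)\pi^{n/2}}$. Then $\Big|\int_{\partial B_1^{n+1}\cap\mathbb{R}^{n+1}_+} y^{3-2s}\,u_e(X)\,d\sigma - c_s\,c_0\Big| \le C$, where $c_s:=\int_{\partial B_1^{n+1}\cap\mathbb{R}^{n+1}_+}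 y^{3-2s}\,d\sigma$. -/
open MeasureTheory Metric Filter Set

noncomputable section

/-- Euclidean space `ℝ^{n+1}`; the last coordinate is the special direction `y`. -/
abbrev E1 (n : ℕ) : Type := EuclideanSpace ℝ (Fin (n + 1))

/-- The horizontal projection `ℝ^{n+1} → ℝ^n`. -/
def projx (n : ℕ) (X : E1 n) : En n :=
  (EuclideanSpace.equiv (Fin n) ℝ).symm (fun i => X (Fin.castSucc i))

/-- The Poisson kernel `P_s(x,y) = κ_{n,s} y^{2s} (|x|² + y²)^{-(n/2+s)}` with
`κ_{n,s} = Γ(n/2+s)/(Γ(s) π^{n/2})`, normalized so that `∫ P_s(x-z,y) dz = 1`. -/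
def Ps (n : ℕ) (s : ℝ) (x : En n) (y : ℝ) : ℝ :=
  (Real.Gamma ((n : ℝ) / 2 + s) / (Real.Gamma s * Real.pi ^ ((n : ℝ) / 2))) *
    y ^ (2 * s) / ((‖x‖ ^ 2 + y ^ 2) ^ ((n : ℝ) / 2 + s))


open scoped ENNReal NNReal

lemma lintegral_rpow_mul_exp {a q : ℝ} (ha : 0 < a) (hq : 0 < q) :
    ∫⁻ t in Ioi (0:ℝ), ENNReal.ofReal (t ^ (a - 1) * Real.exp (-(q * t))) =
      ENNReal.ofReal ((1 / q) ^ a * Real.Gamma a) := by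
  have h := Real.integral_rpow_mul_exp_neg_mul_Ioi ha hq
  have hpos : 0 < (1 / q) ^ a * Real.Gamma a :=
    mul_pos (Real.rpow_pos_of_pos (by positivity) _) (Real.Gamma_pos_of_pos ha)
  have hInt : Integrable (fun t : ℝ => t ^ (a - 1) * Real.exp (-(q * t)))
      (volume.restrict (Ioi 0)) := by
    by_contra hc
    rw [integral_undef hc] at h
    exact hpos.ne h
  rw [← h, ofReal_integral_eq_lintegral_ofReal hInt]
  filter_upwards [ae_restrict_mem measurableSet_Ioi] with t ht
  exact mul_nonneg (Real.rpow_nonneg (le_of_lt ht) _) (Real.exp_pos _).le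

lemma lintegral_exp_neg_mul_norm_sq (n : ℕ) {b : ℝ} (hb : 0 < b) :
    ∫⁻ v : En n, ENNReal.ofReal (Real.exp (-b * ‖v‖ ^ 2)) =
      ENNReal.ofReal ((Real.pi / b) ^ ((n : ℝ) / 2)) := by
  have h := GaussianFourier.integral_rexp_neg_mul_sq_norm (V := En n) hb
  rw [finrank_euclideanSpace_fin] at h
  have hpos : 0 < (Real.pi / b) ^ ((n : ℝ) / 2) :=
    Real.rpow_pos_of_pos (div_pos Real.pi_pos hb) _
  have hInt : Integrable (fun v : En n => Real.exp (-b * ‖v‖ ^ 2)) := by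
    by_contra hc
    rw [integral_undef hc] at h
    exact hpos.ne h
  rw [← h, ofReal_integral_eq_lintegral_ofReal hInt]
  exact ae_of_all _ fun _ => (Real.exp_pos _).le

/-- The total mass of the Poisson kernel. -/
lemma lintegral_poisson (n : ℕ) {s y : ℝ} (hs : 0 < s) (hy : 0 < y) (x : En n) :
    ∫⁻ z : En n, ENNReal.ofReal (y ^ (2 * s) / (‖x - z‖ ^ 2 + y ^ 2) ^ ((n : ℝ) / 2 + s)) =
      ENNReal.ofReal (Real.pi ^ ((n : ℝ) / 2) * Real.Gamma s / Real.Gamma ((n : ℝ) / 2 + s)) := by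
  set a : ℝ := (n : ℝ) / 2 + s with ha_def
  have ha : 0 < a := by positivity
  have hG := Real.Gamma_pos_of_pos ha
  have hyp : 0 < y ^ (2 * s) := Real.rpow_pos_of_pos hy _
  rw [lintegral_sub_left_eq_self (μ := (volume : Measure (En n)))
    (fun z => ENNReal.ofReal (y ^ (2 * s) / (‖z‖ ^ 2 + y ^ 2) ^ a)) x]
  have h1 : ∀ z : En n, ENNReal.ofReal (y ^ (2 * s) / (‖z‖ ^ 2 + y ^ 2) ^ a) =
      ENNReal.ofReal (y ^ (2 * s) / Real.Gamma a) *
        ∫⁻ t in Ioi (0:ℝ), ENNReal.ofReal (t ^ (a - 1) * Real.exp (-((‖z‖ ^ 2 + y ^ 2) * t))) := by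
    intro z
    have hq : 0 < ‖z‖ ^ 2 + y ^ 2 := by positivity
    rw [lintegral_rpow_mul_exp ha hq, ← ENNReal.ofReal_mul (by positivity),
      Real.div_rpow zero_le_one hq.le,
      Real.one_rpow]
    congr 1
    field_simp
  simp_rw [h1]
  rw [lintegral_const_mul' _ _ ENNReal.ofReal_ne_top, lintegral_lintegral_swap]
  swap
  · apply Measurable.aemeasurable
    fun_prop
  have h2 : ∀ t ∈ Ioi (0:ℝ), ∫⁻ z : En n,
      ENNReal.ofReal (t ^ (a - 1) * Real.exp (-((‖z‖ ^ 2 + y ^ 2) * t))) =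
      ENNReal.ofReal (Real.pi ^ ((n : ℝ) / 2)) *
        ENNReal.ofReal (t ^ (s - 1) * Real.exp (-(y ^ 2 * t))) := by
    intro t ht
    have ht : 0 < t := ht
    have : ∀ z : En n, ENNReal.ofReal (t ^ (a - 1) * Real.exp (-((‖z‖ ^ 2 + y ^ 2) * t))) =
        ENNReal.ofReal (t ^ (a - 1) * Real.exp (-(y ^ 2 * t))) *
          ENNReal.ofReal (Real.exp (-t * ‖z‖ ^ 2)) := by
      intro z
      rw [← ENNReal.ofReal_mul (by positivity), mul_assoc, ← Real.exp_add]
      congr 3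
      ring
    simp_rw [this]
    rw [lintegral_const_mul' _ _ ENNReal.ofReal_ne_top, lintegral_exp_neg_mul_norm_sq n ht,
      ← ENNReal.ofReal_mul (by positivity), ← ENNReal.ofReal_mul (by positivity),
      Real.div_rpow Real.pi_pos.le ht.le]
    congr 1
    have : t ^ (a - 1) = t ^ (s - 1) * t ^ ((n : ℝ) / 2) := by
      rw [← Real.rpow_add ht]; congr 1; rw [ha_def]; ring
    rw [this]
    field_simp
  rw [setLIntegral_congr_fun measurableSet_Ioi h2, lintegral_const_mul' _ _ ENNReal.ofReal_ne_top,
    lintegral_rpow_mul_exp hs (by positivity), ← ENNReal.ofReal_mul (by positivity),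
    ← ENNReal.ofReal_mul (by positivity), Real.div_rpow zero_le_one (by positivity),
    Real.one_rpow, ← Real.rpow_natCast, ← Real.rpow_mul hy.le]
  congr 1
  push_cast
  field_simp

lemma lintegral_ball_norm_rpow (n : ℕ) {m r : ℝ} (hm : m < n) (hn : 0 < n) (hr : 0 < r) :
    ∫⁻ z in Metric.ball (0 : En n) r, ENNReal.ofReal (1 / ‖z‖ ^ m) =
      ENNReal.ofReal (n * (volume.real (Metric.ball (0 : En n) 1)) / (n - m) * r ^ (n - m)) := by
  have : Nontrivial (En n) := by
    have : NeZero n := ⟨hn.ne'⟩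
    infer_instance
  have hfr : Module.finrank ℝ (En n) = n := finrank_euclideanSpace_fin
  have e : ∀ z : En n, (Metric.ball (0 : En n) r).indicator (fun z => 1 / ‖z‖ ^ m) z =
      (Iio r).indicator (fun t : ℝ => 1 / t ^ m) ‖z‖ := by
    intro z
    by_cases h : ‖z‖ < r <;> simp [h, indicator]
  have e2 : (fun t : ℝ => t ^ (n - 1) • (Iio r).indicator (fun t : ℝ => 1 / t ^ m) t) =
      (Iio r).indicator (fun t : ℝ => t ^ (n - 1) * (1 / t ^ m)) := by
    ext t
    by_cases h : t < r <;> simp [h, indicator]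
  have e3 : EqOn (fun t : ℝ => t ^ (n - 1) * (1 / t ^ m)) (fun t : ℝ => t ^ ((n:ℝ) - 1 - m))
      (Ioo 0 r) := by
    intro t ht
    have h0 : 0 < t := ht.1
    simp only
    rw [Real.rpow_sub h0, ← Real.rpow_natCast, Nat.cast_sub hn]
    simp [div_eq_mul_inv]
  have e4 : Ioi (0:ℝ) ∩ Iio r = Ioo 0 r := rfl
  have hI : IntegrableOn (fun t : ℝ => t ^ ((n:ℝ) - 1 - m)) (Ioo 0 r) := by
    have := intervalIntegral.intervalIntegrable_rpow' (a := 0) (b := r) (r := (n:ℝ) - 1 - m)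
      (by linarith)
    rw [intervalIntegrable_iff_integrableOn_Ioo_of_le hr.le] at this
    exact this
  have hInt : Integrable (fun z : En n => (Metric.ball (0 : En n) r).indicator
      (fun z => 1 / ‖z‖ ^ m) z) := by
    simp_rw [e]
    rw [integrable_fun_norm_addHaar (E := En n) volume
      (f := (Iio r).indicator (fun t : ℝ => 1 / t ^ m)), hfr, e2, IntegrableOn,
      integrable_indicator_iff measurableSet_Iio, IntegrableOn,
      Measure.restrict_restrict measurableSet_Iio, inter_comm, e4]
    exact (integrableOn_congr_fun e3 measurableSet_Ioo).2 hI
  have hval : ∫ z in Metric.ball (0 : En n) r, 1 / ‖z‖ ^ m =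
      n * (volume.real (Metric.ball (0 : En n) 1)) / (n - m) * r ^ (n - m) := by
    rw [← integral_indicator measurableSet_ball]
    simp_rw [e]
    rw [integral_fun_norm_addHaar (E := En n) volume
      (f := (Iio r).indicator (fun t : ℝ => 1 / t ^ m)), hfr, e2,
      integral_indicator measurableSet_Iio,
      Measure.restrict_restrict measurableSet_Iio, inter_comm, e4,
      setIntegral_congr_fun measurableSet_Ioo e3, ← integral_Ioc_eq_integral_Ioo,
      ← intervalIntegral.integral_of_le hr.le, integral_rpow (Or.inl (by linarith))]
    have : (n:ℝ) - 1 - m + 1 = n - m := by ring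
    have h' : (n:ℝ) - m ≠ 0 := by linarith
    rw [this, Real.zero_rpow h']
    simp
    ring
  rw [← hval, ofReal_integral_eq_lintegral_ofReal
    ((integrable_indicator_iff measurableSet_ball).1 hInt)]
  exact ae_of_all _ fun _ => by positivity

lemma sqrt_sq_add_le {n : ℕ} (x z ξ : En n) (y : ℝ) :
    √(‖x - ξ‖ ^ 2 + y ^ 2) ≤ √(‖x - z‖ ^ 2 + y ^ 2) + ‖z - ξ‖ := by
  have h1 : ‖x - ξ‖ ≤ ‖x - z‖ + ‖z - ξ‖ := by
    simpa using norm_add_le (x - z) (z - ξ)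
  have h2 : ‖x - z‖ ≤ √(‖x - z‖ ^ 2 + y ^ 2) := Real.le_sqrt_of_sq_le (by nlinarith [sq_nonneg y])
  have h3 : √(‖x - z‖ ^ 2 + y ^ 2) ^ 2 = ‖x - z‖ ^ 2 + y ^ 2 := Real.sq_sqrt (by positivity)
  rw [Real.sqrt_le_iff]
  constructor
  · positivity
  · nlinarith [norm_nonneg (x - z), norm_nonneg (z - ξ), norm_nonneg (x - ξ)]

/-- Averaging the power `|z - ξ|^{-m}` against a Poisson-type kernel. -/
lemma exists_lintegral_poisson_mul_rpow_le (n : ℕ) (hn : 0 < n) {t m : ℝ} (ht : 0 < t)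
    (hm0 : 0 ≤ m) (hm : m < n) :
    ∃ C > (0:ℝ), ∀ (x ξ : En n) (y : ℝ), 0 < y →
      ∫⁻ z : En n, ENNReal.ofReal (y ^ (2 * t) / (‖x - z‖ ^ 2 + y ^ 2) ^ ((n : ℝ) / 2 + t) *
          (1 / ‖z - ξ‖ ^ m)) ≤
        ENNReal.ofReal (C / √(‖x - ξ‖ ^ 2 + y ^ 2) ^ m) := by
  set M := Real.pi ^ ((n : ℝ) / 2) * Real.Gamma t / Real.Gamma ((n : ℝ) / 2 + t) with hM
  set B := n * (volume.real (Metric.ball (0 : En n) 1)) / (n - m) with hB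
  have hMpos : 0 < M := div_pos (mul_pos (Real.rpow_pos_of_pos Real.pi_pos _)
    (Real.Gamma_pos_of_pos ht)) (Real.Gamma_pos_of_pos (by positivity))
  have hnm : 0 < (n : ℝ) - m := by linarith
  have hB0 : 0 ≤ B := by positivity
  refine ⟨M * 2 ^ m + 2 ^ ((n : ℝ) + 2 * t) * (B * (1 / 2) ^ ((n : ℝ) - m)), by positivity, ?_⟩
  intro x ξ y hy
  set D := √(‖x - ξ‖ ^ 2 + y ^ 2) with hD
  have hyD : y ≤ D := Real.le_sqrt_of_sq_le (by nlinarith [sq_nonneg ‖x - ξ‖])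
  have hD0 : 0 < D := hy.trans_le hyD
  have key : ∀ z : En n, ENNReal.ofReal (y ^ (2 * t) / (‖x - z‖ ^ 2 + y ^ 2) ^ ((n : ℝ) / 2 + t) *
          (1 / ‖z - ξ‖ ^ m)) ≤
      ENNReal.ofReal (2 ^ m / D ^ m) *
        ENNReal.ofReal (y ^ (2 * t) / (‖x - z‖ ^ 2 + y ^ 2) ^ ((n : ℝ) / 2 + t)) +
      ENNReal.ofReal (2 ^ ((n : ℝ) + 2 * t) / D ^ (n : ℝ)) *
        (Metric.ball (0 : En n) (D / 2)).indicator (fun z => ENNReal.ofReal (1 / ‖z‖ ^ m))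
          (z - ξ) := by
    intro z
    by_cases hz : ‖z - ξ‖ < D / 2
    · have hmem : z - ξ ∈ Metric.ball (0 : En n) (D / 2) := by simpa using hz
      rw [indicator_of_mem hmem]
      refine le_trans ?_ le_add_self
      rw [← ENNReal.ofReal_mul (by positivity)]
      apply ENNReal.ofReal_le_ofReal
      apply mul_le_mul_of_nonneg_right _ (by positivity)
      have h1 : D / 2 ≤ √(‖x - z‖ ^ 2 + y ^ 2) := by
        have := sqrt_sq_add_le x z ξ y
        rw [← hD] at this
        linarith
      have h2 : (D / 2) ^ 2 ≤ ‖x - z‖ ^ 2 + y ^ 2 := by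
        rw [← Real.sq_sqrt (by positivity : 0 ≤ ‖x - z‖ ^ 2 + y ^ 2)]
        gcongr
      have h3 : (D / 2) ^ ((n : ℝ) + 2 * t) ≤ (‖x - z‖ ^ 2 + y ^ 2) ^ ((n : ℝ) / 2 + t) := by
        calc (D / 2) ^ ((n : ℝ) + 2 * t) = ((D / 2) ^ 2) ^ ((n : ℝ) / 2 + t) := by
              rw [← Real.rpow_natCast, ← Real.rpow_mul (by positivity)]
              congr 1
              push_cast
              ring
          _ ≤ _ := by gcongr
      have h4 : y ^ (2 * t) ≤ D ^ (2 * t) := by gcongr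
      calc y ^ (2 * t) / (‖x - z‖ ^ 2 + y ^ 2) ^ ((n : ℝ) / 2 + t)
          ≤ D ^ (2 * t) / (D / 2) ^ ((n : ℝ) + 2 * t) := by gcongr
        _ = 2 ^ ((n : ℝ) + 2 * t) / D ^ (n : ℝ) := by
            rw [Real.div_rpow hD0.le (by norm_num), Real.rpow_add hD0]
            field_simp
    · refine le_trans ?_ le_self_add
      rw [← ENNReal.ofReal_mul (by positivity)]
      apply ENNReal.ofReal_le_ofReal
      rw [mul_comm]
      apply mul_le_mul_of_nonneg_right _ (by positivity)
      push Not at hz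
      calc 1 / ‖z - ξ‖ ^ m ≤ 1 / (D / 2) ^ m := by gcongr
        _ = 2 ^ m / D ^ m := by
          rw [Real.div_rpow hD0.le (by norm_num)]
          field_simp
  refine (lintegral_mono key).trans ?_
  rw [lintegral_add_left (by fun_prop), lintegral_const_mul' _ _ ENNReal.ofReal_ne_top,
    lintegral_const_mul' _ _ ENNReal.ofReal_ne_top, lintegral_poisson n ht hy,
    lintegral_sub_right_eq_self (μ := (volume : Measure (En n)))
      ((Metric.ball (0 : En n) (D / 2)).indicator (fun z => ENNReal.ofReal (1 / ‖z‖ ^ m))) ξ,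
    lintegral_indicator measurableSet_ball, lintegral_ball_norm_rpow n hm hn (by positivity),
    ← ENNReal.ofReal_mul (by positivity), ← ENNReal.ofReal_mul (by positivity),
    ← ENNReal.ofReal_add (by positivity) (by positivity)]
  apply ENNReal.ofReal_le_ofReal
  apply le_of_eq
  rw [← hM, ← hB]
  clear_value M B D
  rw [show D / 2 = (1 / 2) * D by ring, Real.mul_rpow (by norm_num) hD0.le, Real.rpow_sub hD0 n m]
  field_simp

lemma abs_inv_rpow_sub_inv_rpow_le {a b m : ℝ} (ha : 0 ≤ a) (hb : 0 < b) (hm : 0 < m) :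
    |1 / a ^ m - 1 / b ^ m| ≤ (m + 1) * (|a - b| / b) * (1 / a ^ m + 1 / b ^ m) := by
  rcases ha.eq_or_lt with rfl | ha
  · rw [Real.zero_rpow hm.ne', zero_sub, abs_neg, abs_of_pos hb, div_self hb.ne']
    have h : 0 < 1 / b ^ m := by positivity
    simp only [div_zero, zero_sub, abs_neg, zero_add, mul_one]
    rw [abs_of_pos h]
    nlinarith
  have main : ∀ r : ℝ, 0 < r → |1 - r ^ m| ≤ (m + 1) * |r - 1| * (1 + r ^ m) := by
    intro r hr
    have hrm : 0 < r ^ m := by positivity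
    rcases le_total r 1 with h1 | h1
    · have h2 : r ^ m ≤ 1 := Real.rpow_le_one hr.le h1 hm.le
      have h3 : 1 - r ^ m ≤ (m + 1) * (1 - r) := by
        rcases le_total m 1 with h | h
        · have : r ≤ r ^ m := by
            simpa using Real.rpow_le_rpow_of_exponent_ge hr h1 h
          nlinarith
        · have := one_add_mul_self_le_rpow_one_add (s := r - 1) (by linarith) h
          simp only [add_sub_cancel] at this
          nlinarith
      rw [abs_of_nonneg (by linarith), abs_of_nonpos (by linarith)]
      have : 0 ≤ (m + 1) * (1 - r) := mul_nonneg (by linarith) (by linarith)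
      nlinarith
    · have h2 : 1 ≤ r ^ m := Real.one_le_rpow h1 hm.le
      have h3 : r ^ m - 1 ≤ (m + 1) * (r - 1) * r ^ m := by
        have h4 : 1 - r⁻¹ ^ m ≤ m * (r - 1) := by
          have h5 := Real.add_one_le_exp (-(m * Real.log r))
          have h6 : Real.exp (-(m * Real.log r)) = r⁻¹ ^ m := by
            rw [Real.inv_rpow hr.le, Real.rpow_def_of_pos hr, Real.exp_neg, mul_comm]
          have h7 := Real.log_le_sub_one_of_pos hr
          nlinarith
        have h8 : r⁻¹ ^ m * r ^ m = 1 := by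
          rw [Real.inv_rpow hr.le]; exact inv_mul_cancel₀ hrm.ne'
        have h9 := mul_le_mul_of_nonneg_right h4 hrm.le
        nlinarith [mul_nonneg (sub_nonneg.2 h1) hrm.le]
      rw [abs_of_nonpos (by linarith), abs_of_nonneg (by linarith)]
      have : 0 ≤ (m + 1) * (r - 1) := mul_nonneg (by linarith) (by linarith)
      nlinarith
  have h := main (a / b) (by positivity)
  have ham : 0 < a ^ m := by positivity
  have hbm : 0 < b ^ m := by positivity
  rw [Real.div_rpow ha.le hb.le] at h
  have e1 : 1 / a ^ m - 1 / b ^ m = (1 / a ^ m) * (1 - a ^ m / b ^ m) := by field_simp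
  have e2 : |a - b| / b = |a / b - 1| := by
    rw [show a / b - 1 = (a - b) / b by field_simp, abs_div, abs_of_pos hb]
  have e3 : 1 / a ^ m + 1 / b ^ m = (1 / a ^ m) * (1 + a ^ m / b ^ m) := by field_simp
  rw [e1, e2, e3, abs_mul, abs_of_pos (by positivity : 0 < 1 / a ^ m)]
  calc 1 / a ^ m * |1 - a ^ m / b ^ m|
      ≤ 1 / a ^ m * ((m + 1) * |a / b - 1| * (1 + a ^ m / b ^ m)) := by gcongr
    _ = _ := by ring

lemma abs_riesz_difference_le {n : ℕ} {m : ℝ} (hm : 0 < m) (z ξ : En n) :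
    |1 / ‖z - ξ‖ ^ m - 1 / (1 + ‖ξ‖) ^ m| ≤
      (m + 1) * ((1 + ‖z‖) / (1 + ‖ξ‖)) * (1 / ‖z - ξ‖ ^ m + 1 / (1 + ‖ξ‖) ^ m) := by
  refine (abs_inv_rpow_sub_inv_rpow_le (norm_nonneg _) (by positivity) hm).trans ?_
  have : |‖z - ξ‖ - (1 + ‖ξ‖)| ≤ 1 + ‖z‖ := by
    have h1 := norm_sub_le z ξ
    have h2 := norm_sub_norm_le ξ z
    rw [norm_sub_rev] at h2
    rw [abs_le]
    constructor <;> linarith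
  gcongr

lemma hausdorffMeasure_inter_preimage_le {X Y : Type*} [MetricSpace X] [MeasurableSpace X]
    [BorelSpace X] [MetricSpace Y] [MeasurableSpace Y] [BorelSpace Y] {f : X → Y} {T : Set X}
    {L : ℝ≥0} {d : ℝ} (hd : 0 ≤ d)
    (hf : ∀ x ∈ T, ∀ x' ∈ T, dist x x' ≤ L * dist (f x) (f x')) (A : Set Y) :
    Measure.hausdorffMeasure d (T ∩ f ⁻¹' A) ≤ (L : ℝ≥0∞) ^ d * Measure.hausdorffMeasure d A := by
  have h1 : AntilipschitzWith L (T.domRestrict f) :=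
    AntilipschitzWith.of_le_mul_dist fun x x' => hf x x.2 x' x'.2
  have h2 := h1.hausdorffMeasure_preimage_le hd A
  have h3 : T ∩ f ⁻¹' A = Subtype.val '' ((T.domRestrict f) ⁻¹' A) := by
    ext x
    simp [domRestrict, and_comm]
  rw [h3, (isometry_subtype_coe (s := T)).hausdorffMeasure_image (Or.inl hd)]
  exact h2

/-- Forget the `i`-th coordinate of a point of `ℝ^{n+1}`. -/
def dropCoord {n : ℕ} (i : Fin (n + 1)) (X : E1 n) : Fin n → ℝ := fun j => X (i.succAbove j)

lemma continuous_dropCoord {n : ℕ} (i : Fin (n + 1)) : Continuous (dropCoord i) := by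
  unfold dropCoord
  fun_prop

lemma norm_sq_eq_add_sum_dropCoord {n : ℕ} (i : Fin (n + 1)) (X : E1 n) :
    ‖X‖ ^ 2 = X i ^ 2 + ∑ j, dropCoord i X j ^ 2 := by
  rw [EuclideanSpace.norm_sq_eq, Fin.sum_univ_succAbove _ i]
  simp [dropCoord]

lemma abs_dropCoord_le_one {n : ℕ} (i : Fin (n + 1)) {X : E1 n}
    (hX : X ∈ Metric.sphere (0 : E1 n) 1) (j : Fin n) : |dropCoord i X j| ≤ 1 := by
  have h := PiLp.norm_apply_le X (i.succAbove j)
  rw [mem_sphere_zero_iff_norm] at hX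
  rw [hX] at h
  exact h

lemma dist_le_mul_dist_dropCoord {n : ℕ} (i : Fin (n + 1)) {ε c : ℝ} (hε : |ε| = 1) (hc : 0 < c)
    {X X' : E1 n} (hX : X ∈ Metric.sphere (0 : E1 n) 1) (hX' : X' ∈ Metric.sphere (0 : E1 n) 1)
    (h : c ≤ ε * X i) (h' : c ≤ ε * X' i) :
    dist X X' ≤ (n / c + n) * dist (dropCoord i X) (dropCoord i X') := by
  set δ := dist (dropCoord i X) (dropCoord i X')
  have hδj : ∀ j, |dropCoord i X j - dropCoord i X' j| ≤ δ := fun j =>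
    dist_le_pi_dist (dropCoord i X) (dropCoord i X') j
  have e1 := norm_sq_eq_add_sum_dropCoord i X
  have e2 := norm_sq_eq_add_sum_dropCoord i X'
  rw [mem_sphere_zero_iff_norm.1 hX] at e1
  rw [mem_sphere_zero_iff_norm.1 hX'] at e2
  have hsum : |∑ j, dropCoord i X' j ^ 2 - ∑ j, dropCoord i X j ^ 2| ≤ n * (2 * δ) := by
    rw [← Finset.sum_sub_distrib]
    refine (Finset.abs_sum_le_sum_abs _ _).trans ?_
    calc ∑ j, |dropCoord i X' j ^ 2 - dropCoord i X j ^ 2| ≤ ∑ _j : Fin n, 2 * δ := by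
          apply Finset.sum_le_sum
          intro j _
          have h1 := abs_dropCoord_le_one i hX j
          have h2 := abs_dropCoord_le_one i hX' j
          have h3 : |dropCoord i X' j + dropCoord i X j| ≤ 2 := by
            refine (abs_add_le _ _).trans ?_
            linarith
          rw [sq_sub_sq, abs_mul, abs_sub_comm (dropCoord i X' j)]
          exact mul_le_mul h3 (hδj j) (abs_nonneg _) (by norm_num)
      _ = n * (2 * δ) := by simp
  have hdiff : |X i - X' i| ≤ n / c * δ := by
    have h1 : |X i - X' i| * |X i + X' i| ≤ n * (2 * δ) := by
      rw [← abs_mul]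
      refine le_trans (le_of_eq ?_) hsum
      congr 1
      linear_combination e2 - e1
    have h2 : 2 * c ≤ |X i + X' i| := by
      calc 2 * c ≤ ε * (X i + X' i) := by linarith
        _ ≤ |ε * (X i + X' i)| := le_abs_self _
        _ = |X i + X' i| := by rw [abs_mul, hε, one_mul]
    have h3 : |X i - X' i| * (2 * c) ≤ n * (2 * δ) :=
      (mul_le_mul_of_nonneg_left h2 (abs_nonneg _)).trans h1
    rw [div_mul_eq_mul_div, le_div_iff₀ hc]
    linarith
  have hnorm : dist X X' ≤ |X i - X' i| + ∑ j, |dropCoord i X j - dropCoord i X' j| := by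
    have h0 := norm_sq_eq_add_sum_dropCoord i (X - X')
    rw [dist_eq_norm]
    refine le_of_sq_le_sq ?_ (by positivity)
    rw [h0, add_sq, sq_abs]
    have : ∑ j, dropCoord i (X - X') j ^ 2 ≤ (∑ j, |dropCoord i X j - dropCoord i X' j|) ^ 2 := by
      have := Finset.sum_sq_le_sq_sum_of_nonneg (s := Finset.univ)
        (f := fun j => |dropCoord i X j - dropCoord i X' j|) (fun j _ => abs_nonneg _)
      simpa [dropCoord] using this
    have h5 : 0 ≤ 2 * |X i - X' i| * ∑ j, |dropCoord i X j - dropCoord i X' j| := by positivity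
    simp only [PiLp.sub_apply]
    linarith
  calc dist X X' ≤ n / c * δ + ∑ _j : Fin n, δ :=
        hnorm.trans (add_le_add hdiff (Finset.sum_le_sum fun j _ => hδj j))
    _ = _ := by simp; ring

/-- On the part of the unit sphere where the `i`-th coordinate is not small, integrals of functions
of the other coordinates are controlled by Lebesgue integrals over a cube. -/
lemma exists_setLIntegral_sphere_dropCoord_le {n : ℕ} (i : Fin (n + 1)) {c : ℝ} (hc : 0 < c) :
    ∃ K : ℝ≥0∞, K ≠ ⊤ ∧ ∀ g : (Fin n → ℝ) → ℝ≥0∞, Measurable g →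
      ∫⁻ X in {X : E1 n | c ≤ |X i|} ∩ Metric.sphere (0 : E1 n) 1, g (dropCoord i X)
          ∂(Measure.hausdorffMeasure (n : ℝ)) ≤
        K * ∫⁻ v, g v ∂(Measure.pi fun _ : Fin n => volume.restrict (Icc (-1 : ℝ) 1)) := by
  set T : Set (E1 n) := {X : E1 n | c ≤ |X i|} ∩ Metric.sphere (0 : E1 n) 1
  set Q : Set (Fin n → ℝ) := univ.pi fun _ => Icc (-1 : ℝ) 1 with hQ
  set L : ℝ≥0 := ⟨n / c + n, by positivity⟩
  have hmeas : Measurable (dropCoord i) := (continuous_dropCoord i).measurable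
  have hμ : (Measure.hausdorffMeasure (Fintype.card (Fin n)) : Measure (Fin n → ℝ)) = volume :=
    hausdorffMeasure_pi_real
  rw [Fintype.card_fin] at hμ
  have hone : ∀ (ε : ℝ) (hε : |ε| = 1) (A : Set (Fin n → ℝ)),
      Measure.hausdorffMeasure (n : ℝ)
        (({X : E1 n | c ≤ ε * X i} ∩ Metric.sphere (0 : E1 n) 1) ∩ dropCoord i ⁻¹' A) ≤
        (L : ℝ≥0∞) ^ (n : ℝ) * volume A := by
    intro ε hε A
    rw [← hμ]
    apply hausdorffMeasure_inter_preimage_le (Nat.cast_nonneg n)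
    intro X hX X' hX'
    exact dist_le_mul_dist_dropCoord i hε hc hX.2 hX'.2 hX.1 hX'.1
  have hle : ((Measure.hausdorffMeasure (n : ℝ)).restrict T).map (dropCoord i) ≤
      (2 * (L : ℝ≥0∞) ^ (n : ℝ)) •
        (Measure.pi fun _ : Fin n => volume.restrict (Icc (-1 : ℝ) 1)) := by
    rw [← Measure.restrict_pi_pi, ← volume_pi]
    refine Measure.le_iff.2 fun A hA => ?_
    rw [Measure.map_apply hmeas hA, Measure.restrict_apply (hmeas hA), Measure.smul_apply,
      Measure.restrict_apply hA, smul_eq_mul]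
    have hsub : dropCoord i ⁻¹' A ∩ T ⊆
        (({X : E1 n | c ≤ 1 * X i} ∩ Metric.sphere (0 : E1 n) 1) ∩ dropCoord i ⁻¹' (A ∩ Q)) ∪
        (({X : E1 n | c ≤ (-1) * X i} ∩ Metric.sphere (0 : E1 n) 1) ∩
          dropCoord i ⁻¹' (A ∩ Q)) := by
      rintro X ⟨hXA, hXc, hXS⟩
      have hXQ : dropCoord i X ∈ Q := by
        rw [hQ, mem_univ_pi]
        exact fun j => abs_le.1 (abs_dropCoord_le_one i hXS j)
      rcases le_abs.1 (show c ≤ |X i| from hXc) with h | h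
      · exact Or.inl ⟨⟨by simpa using h, hXS⟩, hXA, hXQ⟩
      · exact Or.inr ⟨⟨by simpa using h, hXS⟩, hXA, hXQ⟩
    refine (measure_mono hsub).trans ((measure_union_le _ _).trans ?_)
    rw [mul_assoc, two_mul]
    exact add_le_add (hone 1 (by simp) _) (hone (-1) (by simp) _)
  refine ⟨2 * (L : ℝ≥0∞) ^ (n : ℝ), ENNReal.mul_ne_top (by simp)
    (ENNReal.rpow_ne_top_of_nonneg (by positivity) (by simp)), fun g hg => ?_⟩
  rw [← lintegral_map hg hmeas, ← smul_eq_mul, ← lintegral_smul_measure]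
  exact lintegral_mono' hle le_rfl

lemma lintegral_pi_prod_eq_prod {n : ℕ} (ν : Fin n → Measure ℝ) [∀ i, SigmaFinite (ν i)]
    {g : Fin n → ℝ → ℝ≥0∞} (hg : ∀ i, Measurable (g i)) :
    ∫⁻ v, ∏ i, g i (v i) ∂(Measure.pi ν) = ∏ i, ∫⁻ t, g i t ∂(ν i) := by
  induction n with
  | zero => simp
  | succ n ih =>
    rw [← ((measurePreserving_piFinSuccAbove ν 0).symm _).lintegral_comp_emb
      (MeasurableEquiv.measurableEmbedding _)]
    simp only [Fin.prod_univ_succ, MeasurableEquiv.piFinSuccAbove_symm_apply]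
    simp only [Fin.insertNthEquiv_apply, Fin.insertNth_zero', Fin.cons_zero, Fin.cons_succ]
    rw [← ih (fun i : Fin n => ν i.succ) fun i : Fin n => hg i.succ]
    exact lintegral_prod_mul (hg 0).aemeasurable
      (Finset.measurable_fun_prod _ fun (i : Fin n) _ =>
        (hg i.succ).comp (measurable_pi_apply i)).aemeasurable

lemma setLIntegral_Icc_enorm_rpow_ne_top {γ : ℝ} (hγ : -1 < γ) :
    ∫⁻ t in Icc (-1 : ℝ) 1, ‖t‖ₑ ^ γ ≠ ⊤ := by
  have hI := (intervalIntegral.intervalIntegrable_rpow' (a := 0) (b := 1) hγ)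
  rw [intervalIntegrable_iff_integrableOn_Ioc_of_le zero_le_one] at hI
  have h1 : ∫⁻ t in Ioc (0 : ℝ) 1, ‖t‖ₑ ^ γ ≠ ⊤ := by
    refine ne_of_eq_of_ne (setLIntegral_congr_fun measurableSet_Ioc fun t ht => ?_)
      hI.lintegral_lt_top.ne
    rw [Real.enorm_eq_ofReal ht.1.le, ENNReal.ofReal_rpow_of_pos ht.1]
  have h2 : ∫⁻ t in Ico (-1 : ℝ) 0, ‖t‖ₑ ^ γ = ∫⁻ t in Ioc (0 : ℝ) 1, ‖t‖ₑ ^ γ := by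
    rw [← lintegral_indicator measurableSet_Ico, ← lintegral_indicator measurableSet_Ioc,
      ← lintegral_neg_eq_self]
    congr 1
    ext t
    by_cases h : t ∈ Ioc (0 : ℝ) 1
    · rw [indicator_of_mem h, indicator_of_mem (by constructor <;> linarith [h.1, h.2]), enorm_neg]
    · rw [indicator_of_notMem h, indicator_of_notMem]
      exact fun h' => h ⟨by linarith [h'.2], by linarith [h'.1]⟩
  have hsub : Icc (-1 : ℝ) 1 ⊆ (Ioc 0 1 ∪ Ico (-1) 0) ∪ {0} := by
    intro t ht
    rcases lt_trichotomy t 0 with h | h | h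
    · exact Or.inl (Or.inr ⟨ht.1, h⟩)
    · exact Or.inr h
    · exact Or.inl (Or.inl ⟨h, ht.2⟩)
  refine ne_top_of_le_ne_top ?_ ((lintegral_mono_set hsub).trans ((lintegral_union_le _ _ _).trans
    (add_le_add (lintegral_union_le _ _ _) le_rfl)))
  rw [h2, Measure.restrict_singleton]
  simpa using h1

lemma exists_setLIntegral_enorm_sub_rpow_le {β : ℝ} (hβ0 : 0 < β) (hβ : β < 1) :
    ∃ M : ℝ≥0∞, M ≠ ⊤ ∧ ∀ b : ℝ, ∫⁻ t in Icc (-1 : ℝ) 1, ‖t - b‖ₑ ^ (-β) ≤ M := by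
  refine ⟨∫⁻ t in Icc (-1 : ℝ) 1, ‖t‖ₑ ^ (-β) + 2, ?_, fun b => ?_⟩
  · rw [lintegral_add_right _ measurable_const]
    exact ENNReal.add_ne_top.2 ⟨setLIntegral_Icc_enorm_rpow_ne_top (by linarith),
      by simp [ENNReal.mul_eq_top]⟩
  have key : ∀ t : ℝ, ‖t - b‖ₑ ^ (-β) ≤
      (Icc (-1 : ℝ) 1).indicator (fun t => ‖t‖ₑ ^ (-β)) (t - b) + 1 := by
    intro t
    by_cases h : t - b ∈ Icc (-1 : ℝ) 1
    · rw [indicator_of_mem h]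
      exact le_self_add
    · rw [indicator_of_notMem h, zero_add]
      have h1 : 1 ≤ ‖t - b‖ := by
        by_contra hc
        push Not at hc
        exact h (abs_le.1 hc.le)
      have h2 : (1 : ℝ≥0∞) ≤ ‖t - b‖ₑ := by
        rw [← ofReal_norm]
        simpa using h1
      rw [ENNReal.rpow_neg]
      exact ENNReal.inv_le_one.2 (ENNReal.one_le_rpow h2 hβ0)
  have hm : Measurable fun t : ℝ => (Icc (-1 : ℝ) 1).indicator (fun t => ‖t‖ₑ ^ (-β)) (t - b) :=
    ((by fun_prop : Measurable fun t : ℝ => ‖t‖ₑ ^ (-β)).indicator measurableSet_Icc).comp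
      (measurable_id.sub_const b)
  have hv : ∫⁻ _t in Icc (-1 : ℝ) 1, (1 : ℝ≥0∞) ≤ ∫⁻ _t in Icc (-1 : ℝ) 1, (2 : ℝ≥0∞) :=
    lintegral_mono fun _ => by norm_num
  calc ∫⁻ t in Icc (-1 : ℝ) 1, ‖t - b‖ₑ ^ (-β)
      ≤ ∫⁻ t in Icc (-1 : ℝ) 1,
          ((Icc (-1 : ℝ) 1).indicator (fun t => ‖t‖ₑ ^ (-β)) (t - b) + 1) := lintegral_mono key
    _ = (∫⁻ t in Icc (-1 : ℝ) 1, (Icc (-1 : ℝ) 1).indicator (fun t => ‖t‖ₑ ^ (-β)) (t - b))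
          + ∫⁻ _t in Icc (-1 : ℝ) 1, (1 : ℝ≥0∞) := lintegral_add_left hm _
    _ ≤ (∫⁻ t, (Icc (-1 : ℝ) 1).indicator (fun t => ‖t‖ₑ ^ (-β)) (t - b))
          + ∫⁻ _t in Icc (-1 : ℝ) 1, (2 : ℝ≥0∞) := add_le_add (setLIntegral_le_lintegral _ _) hv
    _ = (∫⁻ t in Icc (-1 : ℝ) 1, ‖t‖ₑ ^ (-β)) + ∫⁻ _t in Icc (-1 : ℝ) 1, (2 : ℝ≥0∞) := by
        rw [lintegral_sub_right_eq_self
          ((Icc (-1 : ℝ) 1).indicator (fun t => ‖t‖ₑ ^ (-β))) b,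
          lintegral_indicator measurableSet_Icc]
    _ = _ := (lintegral_add_right _ measurable_const).symm

/-- Distance from a point of `ℝ^{n+1}` to the boundary point `(ξ, 0)`. -/
def bdist {n : ℕ} (X : E1 n) (ξ : En n) : ℝ :=
  √(‖projx n X - ξ‖ ^ 2 + X (Fin.last n) ^ 2)

lemma abs_sub_le_bdist {n : ℕ} (X : E1 n) (ξ : En n) (k : Fin n) :
    |X k.castSucc - ξ k| ≤ bdist X ξ := by
  refine (PiLp.norm_apply_le (projx n X - ξ) k).trans ?_
  exact Real.le_sqrt_of_sq_le (by nlinarith [sq_nonneg (X (Fin.last n))])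

lemma last_le_bdist {n : ℕ} (X : E1 n) (ξ : En n) : X (Fin.last n) ≤ bdist X ξ :=
  Real.le_sqrt_of_sq_le (by nlinarith [sq_nonneg ‖projx n X - ξ‖])

lemma norm_sq_eq_projx {n : ℕ} (X : E1 n) :
    ‖X‖ ^ 2 = ‖projx n X‖ ^ 2 + X (Fin.last n) ^ 2 := by
  rw [EuclideanSpace.norm_sq_eq, EuclideanSpace.norm_sq_eq, Fin.sum_univ_castSucc]
  simp [projx]

lemma bdist_zero {n : ℕ} {X : E1 n} (hX : X ∈ Metric.sphere (0 : E1 n) 1) : bdist X 0 = 1 := by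
  have := norm_sq_eq_projx X
  rw [mem_sphere_zero_iff_norm.1 hX] at this
  rw [bdist, sub_zero, ← this]
  simp

lemma norm_sub_norm_le_bdist {n : ℕ} (X : E1 n) (ξ : En n) : ‖ξ‖ - ‖X‖ ≤ bdist X ξ := by
  have h1 : ‖projx n X‖ ≤ ‖X‖ :=
    le_of_sq_le_sq (by nlinarith [norm_sq_eq_projx X, sq_nonneg (X (Fin.last n))]) (norm_nonneg _)
  have h2 : ‖projx n X - ξ‖ ≤ bdist X ξ :=
    Real.le_sqrt_of_sq_le (by nlinarith [sq_nonneg (X (Fin.last n))])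
  have h3 := norm_sub_norm_le ξ (projx n X)
  rw [norm_sub_rev] at h3
  linarith

/-- The open upper unit hemisphere. -/
def upperHemisphere (n : ℕ) : Set (E1 n) :=
  {X : E1 n | 0 < X (Fin.last n)} ∩ Metric.sphere (0 : E1 n) 1

/-- The surface measure on the open upper unit hemisphere. -/
def hemiMeasure (n : ℕ) : Measure (E1 n) :=
  (Measure.hausdorffMeasure (n : ℝ)).restrict (upperHemisphere n)

lemma measurableSet_upperHemisphere (n : ℕ) : MeasurableSet (upperHemisphere n) :=
  (isOpen_lt continuous_const (by fun_prop)).measurableSet.inter isClosed_sphere.measurableSet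

lemma continuous_projx (n : ℕ) : Continuous (projx n) := by
  unfold projx
  fun_prop

lemma last_le_one {n : ℕ} {X : E1 n} (hX : X ∈ Metric.sphere (0 : E1 n) 1) :
    X (Fin.last n) ≤ 1 := by
  have h := PiLp.norm_apply_le X (Fin.last n)
  rw [mem_sphere_zero_iff_norm.1 hX] at h
  exact (le_abs_self _).trans h

lemma exists_abs_coord_ge {n : ℕ} {X : E1 n} (hX : X ∈ Metric.sphere (0 : E1 n) 1) :
    ∃ i, 1 / ((n : ℝ) + 1) ≤ |X i| := by
  by_contra! hc
  have h : ‖X‖ ^ 2 = ∑ i, X i ^ 2 := by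
    rw [EuclideanSpace.norm_sq_eq]
    simp
  rw [mem_sphere_zero_iff_norm.1 hX] at h
  have hn : (0:ℝ) < (n : ℝ) + 1 := by positivity
  have h2 : ∑ i, X i ^ 2 < ∑ _i : Fin (n + 1), (1 / ((n : ℝ) + 1)) := by
    apply Finset.sum_lt_sum_of_nonempty Finset.univ_nonempty
    intro i _
    have h3 := hc i
    have h4 : 1 / ((n : ℝ) + 1) ≤ 1 := by
      rw [div_le_one hn]
      linarith [(Nat.cast_nonneg n : (0:ℝ) ≤ n)]
    rw [← sq_abs]
    nlinarith [abs_nonneg (X i)]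
  simp only [Finset.sum_const, Finset.card_univ, Fintype.card_fin, nsmul_eq_mul] at h2
  push_cast at h2
  rw [mul_one_div_cancel hn.ne'] at h2
  linarith

lemma exists_setLIntegral_upperHemisphere_inter_le {n : ℕ} {a m : ℝ} (ha : -1 < a) (hm : 0 < m)
    (hmn : m + 1 < n) (i : Fin (n + 1)) {c : ℝ} (hc : 0 < c) :
    ∃ K : ℝ≥0∞, K ≠ ⊤ ∧ ∀ ξ : En n,
      ∫⁻ X in {X : E1 n | c ≤ |X i|} ∩ upperHemisphere n,
        ENNReal.ofReal (X (Fin.last n) ^ a / bdist X ξ ^ m)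
          ∂(Measure.hausdorffMeasure (n : ℝ)) ≤ K := by
  obtain ⟨K, hK, hKi⟩ := exists_setLIntegral_sphere_dropCoord_le i hc
  have hTmeas : MeasurableSet ({X : E1 n | c ≤ |X i|} ∩ upperHemisphere n) :=
    ((isClosed_le continuous_const (by fun_prop)).measurableSet).inter
      (measurableSet_upperHemisphere n)
  have hsub : {X : E1 n | c ≤ |X i|} ∩ upperHemisphere n ⊆
      {X : E1 n | c ≤ |X i|} ∩ Metric.sphere (0 : E1 n) 1 := fun X hX => ⟨hX.1, hX.2.2⟩
  have reduce : ∀ (g : (Fin n → ℝ) → ℝ≥0∞) (ξ : En n), Measurable g →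
      (∀ X ∈ {X : E1 n | c ≤ |X i|} ∩ upperHemisphere n,
        ENNReal.ofReal (X (Fin.last n) ^ a / bdist X ξ ^ m) ≤ g (dropCoord i X)) →
      ∫⁻ X in {X : E1 n | c ≤ |X i|} ∩ upperHemisphere n,
        ENNReal.ofReal (X (Fin.last n) ^ a / bdist X ξ ^ m)
          ∂(Measure.hausdorffMeasure (n : ℝ)) ≤
        K * ∫⁻ v, g v ∂(Measure.pi fun _ : Fin n => volume.restrict (Icc (-1 : ℝ) 1)) :=
    fun g ξ hg h => ((setLIntegral_mono' hTmeas h).trans (lintegral_mono_set hsub)).trans (hKi g hg)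
  by_cases hi : Fin.last n = i
  · subst hi
    refine ⟨K * ∫⁻ _v, ENNReal.ofReal ((c ^ a + 1) / c ^ m)
      ∂(Measure.pi fun _ : Fin n => volume.restrict (Icc (-1 : ℝ) 1)), ?_, fun ξ => ?_⟩
    · refine ENNReal.mul_ne_top hK ?_
      rw [lintegral_const]
      exact ENNReal.mul_ne_top ENNReal.ofReal_ne_top (measure_ne_top _ _)
    · refine reduce (fun _ => ENNReal.ofReal ((c ^ a + 1) / c ^ m)) ξ measurable_const ?_
      rintro X ⟨hX, hX0, hX1⟩
      have hy0 : 0 < X (Fin.last n) := hX0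
      have hcy : c ≤ X (Fin.last n) := by
        rw [← abs_of_pos hy0]
        exact hX
      have hy1 := last_le_one hX1
      have hcD : c ≤ bdist X ξ := hcy.trans (last_le_bdist X ξ)
      have hya : X (Fin.last n) ^ a ≤ c ^ a + 1 := by
        have hca : 0 < c ^ a := Real.rpow_pos_of_pos hc _
        rcases le_total 0 a with h | h
        · linarith [Real.rpow_le_one hy0.le hy1 h]
        · linarith [Real.rpow_le_rpow_of_nonpos hc hcy h]
      gcongr
  · obtain ⟨j₀, hj₀⟩ := Fin.exists_succAbove_eq hi
    have hn0 : 0 < n := j₀.pos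
    have hn1 : 0 < (n : ℝ) - 1 := by linarith
    set β : ℝ := m / ((n : ℝ) - 1) with hβ
    have hβ0 : 0 < β := by positivity
    have hβ1 : β < 1 := by
      rw [hβ, div_lt_one hn1]
      linarith
    obtain ⟨M, hM, hMb⟩ := exists_setLIntegral_enorm_sub_rpow_le hβ0 hβ1
    have hA := setLIntegral_Icc_enorm_rpow_ne_top ha
    refine ⟨K * ∏ _j : Fin n, (∫⁻ t in Icc (-1 : ℝ) 1, ‖t‖ₑ ^ a + M), ?_, fun ξ => ?_⟩
    · refine ENNReal.mul_ne_top hK ?_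
      rw [Finset.prod_const]
      refine ENNReal.pow_ne_top ?_
      rw [lintegral_add_right _ measurable_const]
      exact ENNReal.add_ne_top.2 ⟨hA, by simp [ENNReal.mul_eq_top, hM]⟩
    set ξ' : Fin (n + 1) → ℝ := Fin.snoc (α := fun _ => ℝ) (fun k => ξ k) 0 with hξ'
    set g : Fin n → ℝ → ℝ≥0∞ := fun j t =>
      if j = j₀ then ‖t‖ₑ ^ a else ‖t - ξ' (i.succAbove j)‖ₑ ^ (-β) with hg
    have hgm : ∀ j, Measurable (g j) := by
      intro j
      by_cases h : j = j₀
      · simp only [hg, h, if_true]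
        fun_prop
      · simp only [hg, h, if_false]
        fun_prop
    refine (reduce (fun v => ∏ j, g j (v j)) ξ
      (Finset.measurable_fun_prod _ fun j _ => (hgm j).comp (measurable_pi_apply j)) ?_).trans ?_
    · rintro X ⟨-, hX0, -⟩
      have hy0 : 0 < X (Fin.last n) := hX0
      set D := bdist X ξ with hD
      have hD0 : 0 < D := hy0.trans_le (last_le_bdist X ξ)
      have hDm : D ^ m = (D ^ β) ^ (n - 1) := by
        rw [← Real.rpow_natCast, ← Real.rpow_mul hD0.le, Nat.cast_sub hn0, Nat.cast_one, hβ,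
          div_mul_cancel₀ _ hn1.ne']
      have hval : ENNReal.ofReal (X (Fin.last n) ^ a / D ^ m) =
          ‖X (Fin.last n)‖ₑ ^ a * ∏ _j ∈ ({j₀} : Finset (Fin n))ᶜ, ‖D‖ₑ ^ (-β) := by
        rw [Finset.prod_const, Finset.card_compl, Fintype.card_fin, Finset.card_singleton,
          Real.enorm_eq_ofReal hy0.le, Real.enorm_eq_ofReal hD0.le,
          ENNReal.ofReal_rpow_of_pos hy0, ENNReal.ofReal_rpow_of_pos hD0,
          ← ENNReal.ofReal_pow (by positivity), ← ENNReal.ofReal_mul (by positivity),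
          Real.rpow_neg hD0.le, inv_pow, ← hDm, div_eq_mul_inv]
      rw [hval, Fintype.prod_eq_mul_prod_compl j₀]
      refine mul_le_mul' (le_of_eq ?_) (Finset.prod_le_prod' fun j hj => ?_)
      · simp [hg, dropCoord, hj₀]
      · have hj' : j ≠ j₀ := by simpa using hj
        have hne : i.succAbove j ≠ Fin.last n := fun h =>
          hj' (Fin.succAbove_right_injective (h.trans hj₀.symm))
        obtain ⟨k, hk⟩ := Fin.exists_castSucc_eq.2 hne
        simp only [hg, hj', if_false, dropCoord]
        rw [← hk, hξ', Fin.snoc_castSucc, ENNReal.rpow_neg, ENNReal.rpow_neg, ENNReal.inv_le_inv]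
        refine ENNReal.rpow_le_rpow ?_ hβ0.le
        rw [enorm_le_iff_norm_le, Real.norm_of_nonneg hD0.le]
        exact abs_sub_le_bdist X ξ k
    · rw [lintegral_pi_prod_eq_prod _ hgm]
      refine mul_le_mul' le_rfl (Finset.prod_le_prod' fun j _ => ?_)
      by_cases h : j = j₀
      · simp only [hg, h, if_true]
        exact lintegral_mono fun t => le_self_add
      · simp only [hg, h, if_false]
        refine (hMb _).trans ?_
        rw [lintegral_add_right _ measurable_const]
        refine le_trans ?_ le_add_self
        simp only [lintegral_const, Measure.restrict_apply_univ, Real.volume_Icc]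
        nth_rewrite 1 [← mul_one M]
        gcongr
        norm_num

/-- The weighted sphere integral of the fundamental solution with pole `(ξ, 0)`. -/
lemma exists_lintegral_hemiMeasure_le {n : ℕ} {a m : ℝ} (ha : -1 < a) (hm : 0 < m)
    (hmn : m + 1 < n) :
    ∃ C > (0:ℝ), ∀ ξ : En n,
      ∫⁻ X, ENNReal.ofReal (X (Fin.last n) ^ a / bdist X ξ ^ m) ∂(hemiMeasure n) ≤
        ENNReal.ofReal (C / (1 + ‖ξ‖) ^ m) := by
  have hc : 0 < 1 / ((n : ℝ) + 1) := by positivity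
  choose K hK hKb using fun i =>
    exists_setLIntegral_upperHemisphere_inter_le (n := n) ha hm hmn i hc
  have hcov : upperHemisphere n ⊆
      ⋃ i, {X : E1 n | 1 / ((n : ℝ) + 1) ≤ |X i|} ∩ upperHemisphere n := by
    intro X hX
    obtain ⟨i, hi⟩ := exists_abs_coord_ge hX.2
    exact mem_iUnion.2 ⟨i, hi, hX⟩
  have hbd : ∀ ξ : En n,
      ∫⁻ X, ENNReal.ofReal (X (Fin.last n) ^ a / bdist X ξ ^ m) ∂(hemiMeasure n) ≤ ∑ i, K i := by
    intro ξ
    refine (lintegral_mono_set hcov).trans ((lintegral_iUnion_le _ _).trans ?_)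
    rw [tsum_fintype]
    exact Finset.sum_le_sum fun i _ => hKb i ξ
  have hKs : ∑ i, K i ≠ ⊤ := ENNReal.sum_ne_top.2 fun i _ => hK i
  set S := (∑ i, K i).toReal with hS
  have hSK : ∑ i, K i = ENNReal.ofReal S := (ENNReal.ofReal_toReal hKs).symm
  have hS0 : 0 ≤ S := ENNReal.toReal_nonneg
  refine ⟨6 ^ m * (S + 1), by positivity, fun ξ => ?_⟩
  rcases le_total ‖ξ‖ 2 with hξ | hξ
  · refine (hbd ξ).trans ?_
    rw [hSK]
    apply ENNReal.ofReal_le_ofReal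
    rw [le_div_iff₀ (by positivity)]
    have : (1 + ‖ξ‖) ^ m ≤ 6 ^ m := by
      gcongr
      linarith
    nlinarith [Real.rpow_pos_of_pos (by norm_num : (0:ℝ) < 6) m]
  · have key : ∀ X ∈ upperHemisphere n, ENNReal.ofReal (X (Fin.last n) ^ a / bdist X ξ ^ m) ≤
        ENNReal.ofReal (6 ^ m / (1 + ‖ξ‖) ^ m) *
          ENNReal.ofReal (X (Fin.last n) ^ a / bdist X 0 ^ m) := by
      rintro X ⟨hX0, hX1⟩
      have hy0 : 0 < X (Fin.last n) := hX0
      rw [← ENNReal.ofReal_mul (by positivity), bdist_zero hX1]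
      apply ENNReal.ofReal_le_ofReal
      have h1 := norm_sub_norm_le_bdist X ξ
      rw [mem_sphere_zero_iff_norm.1 hX1] at h1
      have h2 : (1 + ‖ξ‖) / 6 ≤ bdist X ξ := by linarith
      calc X (Fin.last n) ^ a / bdist X ξ ^ m ≤ X (Fin.last n) ^ a / ((1 + ‖ξ‖) / 6) ^ m := by
            gcongr
        _ = _ := by
            rw [Real.div_rpow (by positivity) (by norm_num)]
            simp
            field_simp
    refine (setLIntegral_mono' (measurableSet_upperHemisphere n) key).trans ?_
    rw [lintegral_const_mul' _ _ ENNReal.ofReal_ne_top]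
    refine (mul_le_mul_right (hbd 0) _).trans ?_
    rw [hSK, ← ENNReal.ofReal_mul (by positivity)]
    apply ENNReal.ofReal_le_ofReal
    rw [div_mul_eq_mul_div]
    gcongr
    linarith

/-- A density with `∫_{B_r} f ≤ C₀ r^m` is integrable against `(1 + |ξ|)^{-m-1}`, quantitatively. -/
lemma lintegral_mul_inv_rpow_le {n : ℕ} {m C₀ : ℝ} (hm : 0 < m) (hC₀ : 0 < C₀) {f : En n → ℝ}
    (hf : Measurable f)
    (hgrowth : ∀ r : ℝ, 1 ≤ r → ∫⁻ z in Metric.ball (0 : En n) r, ENNReal.ofReal (f z) ≤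
      ENNReal.ofReal (C₀ * r ^ m)) :
    ∫⁻ ξ, ENNReal.ofReal (f ξ) * ENNReal.ofReal (1 / (1 + ‖ξ‖) ^ (m + 1)) ≤
      ENNReal.ofReal (C₀ * 2 ^ m * 2) := by
  set F : ℕ → En n → ℝ≥0∞ := fun k => (Metric.ball (0 : En n) (2 ^ (k + 1))).indicator
    fun ξ => ENNReal.ofReal (1 / (2 ^ k) ^ (m + 1)) * ENNReal.ofReal (f ξ) with hF
  have hpt : ∀ ξ, ENNReal.ofReal (f ξ) * ENNReal.ofReal (1 / (1 + ‖ξ‖) ^ (m + 1)) ≤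
      ∑' k, F k ξ := by
    intro ξ
    have hex : ∃ k : ℕ, ‖ξ‖ < 2 ^ (k + 1) := by
      obtain ⟨k, hk⟩ := pow_unbounded_of_one_lt ‖ξ‖ (by norm_num : (1:ℝ) < 2)
      exact ⟨k, hk.trans (pow_lt_pow_right₀ (by norm_num) (Nat.lt_succ_self k))⟩
    classical
    set k := Nat.find hex with hk
    have h1 : ‖ξ‖ < 2 ^ (k + 1) := Nat.find_spec hex
    have h2 : (2:ℝ) ^ k ≤ 1 + ‖ξ‖ := by
      rcases Nat.eq_zero_or_pos k with h0 | h0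
      · rw [h0]
        simp
      · have := Nat.find_min hex (m := k - 1) (Nat.sub_lt h0 one_pos)
        rw [show k - 1 + 1 = k by omega] at this
        push Not at this
        linarith
    refine le_trans ?_ (ENNReal.le_tsum k)
    have hmem : ξ ∈ Metric.ball (0 : En n) (2 ^ (k + 1)) := by simpa using h1
    simp only [hF]
    rw [indicator_of_mem hmem, mul_comm]
    gcongr
  refine (lintegral_mono hpt).trans ?_
  have hFm : ∀ k, AEMeasurable (F k) := fun k =>
    ((hf.ennreal_ofReal.const_mul _).indicator measurableSet_ball).aemeasurable
  rw [lintegral_tsum hFm]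
  have hk : ∀ k, ∫⁻ ξ, F k ξ ≤ ENNReal.ofReal (C₀ * 2 ^ m * (1 / 2) ^ k) := by
    intro k
    simp only [hF]
    rw [lintegral_indicator measurableSet_ball, lintegral_const_mul' _ _ ENNReal.ofReal_ne_top]
    refine (mul_le_mul_right (hgrowth _ (one_le_pow₀ (by norm_num))) _).trans ?_
    rw [← ENNReal.ofReal_mul (by positivity)]
    apply ENNReal.ofReal_le_ofReal
    apply le_of_eq
    rw [pow_succ, Real.mul_rpow (by positivity) (by norm_num), Real.rpow_add (by positivity),
      Real.rpow_one, one_div_pow]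
    field_simp
  refine (ENNReal.tsum_le_tsum hk).trans ?_
  rw [← ENNReal.ofReal_tsum_of_nonneg (fun k => by positivity)
    (summable_geometric_two.mul_left _), tsum_mul_left, tsum_geometric_two]

/-- The unnormalized Poisson kernel. -/
def poissonCore (n : ℕ) (t : ℝ) (x : En n) (y : ℝ) : ℝ :=
  y ^ (2 * t) / (‖x‖ ^ 2 + y ^ 2) ^ ((n : ℝ) / 2 + t)

lemma poissonCore_nonneg (n : ℕ) (t : ℝ) (x : En n) {y : ℝ} (hy : 0 ≤ y) :
    0 ≤ poissonCore n t x y := by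
  unfold poissonCore
  positivity

lemma poissonCore_mul_le {n : ℕ} {t : ℝ} {X : E1 n} (hX : X ∈ upperHemisphere n) (z : En n) :
    poissonCore n t (projx n X - z) (X (Fin.last n)) * (1 + ‖z‖) ≤
      2 * poissonCore n t (projx n X - z) (X (Fin.last n)) +
        poissonCore n (t - 1 / 2) (projx n X - z) (X (Fin.last n)) := by
  set x := projx n X
  set y := X (Fin.last n)
  have hy0 : 0 < y := hX.1
  have hy1 : y ≤ 1 := last_le_one hX.2
  have hx : ‖x‖ ≤ 1 := by
    have h := norm_sq_eq_projx X
    rw [mem_sphere_zero_iff_norm.1 hX.2] at h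
    exact le_of_sq_le_sq (by nlinarith [sq_nonneg y]) zero_le_one
  have hq : 0 < ‖x - z‖ ^ 2 + y ^ 2 := by positivity
  set q := ‖x - z‖ ^ 2 + y ^ 2 with hqd
  have hz : ‖z‖ ≤ 1 + q ^ (1 / 2 : ℝ) := by
    have h1 : ‖z‖ ≤ ‖x‖ + ‖x - z‖ := by
      have := norm_sub_norm_le z x
      rw [norm_sub_rev] at this
      linarith
    have h2 : ‖x - z‖ ≤ q ^ (1 / 2 : ℝ) := by
      rw [← Real.sqrt_eq_rpow]
      exact Real.le_sqrt_of_sq_le (by nlinarith [sq_nonneg y])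
    linarith
  have hP := poissonCore_nonneg n t (x - z) hy0.le
  have hlast : poissonCore n t (x - z) y * q ^ (1 / 2 : ℝ) ≤
      poissonCore n (t - 1 / 2) (x - z) y := by
    unfold poissonCore
    rw [← hqd, show (n : ℝ) / 2 + (t - 1 / 2) = (n : ℝ) / 2 + t - 1 / 2 by ring,
      Real.rpow_sub hq, show 2 * (t - 1 / 2) = 2 * t - 1 by ring, Real.rpow_sub hy0, Real.rpow_one]
    have h3 : y ^ (2 * t) ≤ y ^ (2 * t) / y :=
      le_div_self (by positivity) hy0 hy1
    calc y ^ (2 * t) / q ^ ((n : ℝ) / 2 + t) * q ^ (1 / 2 : ℝ)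
        = y ^ (2 * t) / (q ^ ((n : ℝ) / 2 + t) / q ^ (1 / 2 : ℝ)) := by field_simp
      _ ≤ _ := by gcongr
  nlinarith [mul_le_mul_of_nonneg_left hz hP]

/-- Averaging the renormalized Riesz kernel against the Poisson kernel on the hemisphere. -/
lemma exists_lintegral_poissonCore_mul_riesz_le (n : ℕ) {t m : ℝ} (ht : 1 / 2 < t)
    (hm0 : 0 < m) (hm : m < n) :
    ∃ C > (0:ℝ), ∀ X ∈ upperHemisphere n, ∀ ξ : En n,
      ∫⁻ z : En n, ENNReal.ofReal (poissonCore n t (projx n X - z) (X (Fin.last n))) *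
          ENNReal.ofReal |1 / ‖z - ξ‖ ^ m - 1 / (1 + ‖ξ‖) ^ m| ≤
        ENNReal.ofReal (C / (1 + ‖ξ‖) * (1 / bdist X ξ ^ m + 1 / (1 + ‖ξ‖) ^ m)) := by
  have hn : 0 < n := by
    have : (0:ℝ) < n := hm0.trans hm
    exact_mod_cast this
  have ht0 : 0 < t := by linarith
  have ht1 : 0 < t - 1 / 2 := by linarith
  obtain ⟨C₁, hC₁, h₁⟩ := exists_lintegral_poisson_mul_rpow_le n hn ht0 hm0.le hm
  obtain ⟨C₂, hC₂, h₂⟩ := exists_lintegral_poisson_mul_rpow_le n hn ht1 hm0.le hm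
  obtain ⟨C₃, hC₃, h₃⟩ := exists_lintegral_poisson_mul_rpow_le n hn ht0 le_rfl (by simpa using hn)
  obtain ⟨C₄, hC₄, h₄⟩ := exists_lintegral_poisson_mul_rpow_le n hn ht1 le_rfl (by simpa using hn)
  simp only [Real.rpow_zero, div_one, mul_one] at h₃ h₄
  refine ⟨(m + 1) * (2 * C₁ + C₂ + 2 * C₃ + C₄), by positivity, fun X hX ξ => ?_⟩
  set x := projx n X
  set y := X (Fin.last n) with hy
  have hy0 : 0 < y := hX.1
  have hD0 : 0 < bdist X ξ := hy0.trans_le (last_le_bdist X ξ)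
  set b := 1 + ‖ξ‖ with hb
  have hb0 : 0 < b := by positivity
  set P : En n → ℝ≥0∞ := fun z => ENNReal.ofReal (poissonCore n t (x - z) y) with hP
  set Q : En n → ℝ≥0∞ := fun z => ENNReal.ofReal (poissonCore n (t - 1 / 2) (x - z) y) with hQ
  set R : En n → ℝ≥0∞ := fun z => ENNReal.ofReal (1 / ‖z - ξ‖ ^ m) with hR
  have hPm : Measurable P := by
    simp only [hP, poissonCore]
    fun_prop
  have hQm : Measurable Q := by
    simp only [hQ, poissonCore]
    fun_prop
  have hRm : Measurable R := by
    simp only [hR]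
    fun_prop
  have key : ∀ z, P z * ENNReal.ofReal |1 / ‖z - ξ‖ ^ m - 1 / b ^ m| ≤
      ENNReal.ofReal ((m + 1) / b) * ((2 * (P z * R z) + Q z * R z) +
        ENNReal.ofReal (1 / b ^ m) * (2 * P z + Q z)) := by
    intro z
    have hP0 := poissonCore_nonneg n t (x - z) hy0.le
    have hQ0 := poissonCore_nonneg n (t - 1 / 2) (x - z) hy0.le
    have e : ENNReal.ofReal ((m + 1) / b) * ((2 * (P z * R z) + Q z * R z) +
        ENNReal.ofReal (1 / b ^ m) * (2 * P z + Q z)) =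
        ENNReal.ofReal ((m + 1) / b * ((2 * poissonCore n t (x - z) y +
          poissonCore n (t - 1 / 2) (x - z) y) * (1 / ‖z - ξ‖ ^ m + 1 / b ^ m))) := by
      rw [ENNReal.ofReal_mul (by positivity), ENNReal.ofReal_mul (by positivity),
        ENNReal.ofReal_add (by positivity) (by positivity),
        ENNReal.ofReal_add (by positivity) (by positivity), ENNReal.ofReal_mul (by positivity),
        ENNReal.ofReal_ofNat]
      ring
    rw [e, hP, ← ENNReal.ofReal_mul hP0]
    apply ENNReal.ofReal_le_ofReal
    calc poissonCore n t (x - z) y * |1 / ‖z - ξ‖ ^ m - 1 / b ^ m|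
        ≤ poissonCore n t (x - z) y * ((m + 1) * ((1 + ‖z‖) / b) *
            (1 / ‖z - ξ‖ ^ m + 1 / b ^ m)) :=
          mul_le_mul_of_nonneg_left (abs_riesz_difference_le hm0 z ξ) hP0
      _ = (m + 1) / b * ((poissonCore n t (x - z) y * (1 + ‖z‖)) *
            (1 / ‖z - ξ‖ ^ m + 1 / b ^ m)) := by ring
      _ ≤ _ := by
          gcongr
          exact poissonCore_mul_le hX z
  refine (lintegral_mono key).trans ?_
  have hPR : ∫⁻ z, P z * R z ≤ ENNReal.ofReal (C₁ / bdist X ξ ^ m) := by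
    refine le_of_eq_of_le (lintegral_congr fun z => ?_) (h₁ x ξ y hy0)
    rw [hP, hR, ← ENNReal.ofReal_mul (poissonCore_nonneg n t (x - z) hy0.le)]
    rfl
  have hQR : ∫⁻ z, Q z * R z ≤ ENNReal.ofReal (C₂ / bdist X ξ ^ m) := by
    refine le_of_eq_of_le (lintegral_congr fun z => ?_) (h₂ x ξ y hy0)
    rw [hQ, hR, ← ENNReal.ofReal_mul (poissonCore_nonneg n (t - 1 / 2) (x - z) hy0.le)]
    rfl
  have hP1 : ∫⁻ z, P z ≤ ENNReal.ofReal C₃ := h₃ x ξ y hy0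
  have hQ1 : ∫⁻ z, Q z ≤ ENNReal.ofReal C₄ := h₄ x ξ y hy0
  rw [lintegral_const_mul' _ _ ENNReal.ofReal_ne_top, lintegral_add_left (by fun_prop),
    lintegral_add_left (by fun_prop), lintegral_const_mul' _ _ (by simp),
    lintegral_const_mul' _ _ ENNReal.ofReal_ne_top, lintegral_add_left (by fun_prop),
    lintegral_const_mul' _ _ (by simp)]
  calc _ ≤ ENNReal.ofReal ((m + 1) / b) * ((2 * ENNReal.ofReal (C₁ / bdist X ξ ^ m) +
        ENNReal.ofReal (C₂ / bdist X ξ ^ m)) +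
        ENNReal.ofReal (1 / b ^ m) * (2 * ENNReal.ofReal C₃ + ENNReal.ofReal C₄)) := by gcongr
    _ = ENNReal.ofReal ((m + 1) / b * ((2 * (C₁ / bdist X ξ ^ m) + C₂ / bdist X ξ ^ m) +
        1 / b ^ m * (2 * C₃ + C₄))) := by
        rw [ENNReal.ofReal_mul (by positivity), ENNReal.ofReal_add (by positivity) (by positivity),
        ENNReal.ofReal_add (by positivity) (by positivity), ENNReal.ofReal_mul (by positivity),
        ENNReal.ofReal_mul (by positivity : 0 ≤ 1 / b ^ m),
        ENNReal.ofReal_add (by positivity) (by positivity),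
        ENNReal.ofReal_mul (by positivity : (0:ℝ) ≤ 2),
        ENNReal.ofReal_ofNat]
    _ ≤ _ := by
        apply ENNReal.ofReal_le_ofReal
        have hu : 0 < 1 / bdist X ξ ^ m := by positivity
        have hv : 0 < 1 / b ^ m := by positivity
        rw [div_eq_mul_one_div C₁, div_eq_mul_one_div C₂]
        set u := 1 / bdist X ξ ^ m
        set v := 1 / b ^ m
        have h5 : (2 * (C₁ * u) + C₂ * u) + v * (2 * C₃ + C₄) ≤
            (2 * C₁ + C₂ + 2 * C₃ + C₄) * (u + v) := by
          have := mul_pos hC₁ hv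
          have := mul_pos hC₂ hv
          have := mul_pos hC₃ hu
          have := mul_pos hC₄ hu
          nlinarith
        calc _ ≤ (m + 1) / b * ((2 * C₁ + C₂ + 2 * C₃ + C₄) * (u + v)) := by gcongr
          _ = _ := by ring

lemma continuous_last (n : ℕ) : Continuous fun X : E1 n => X (Fin.last n) := by
  fun_prop

lemma measurable_uncurry_poissonCore (n : ℕ) (t : ℝ) :
    Measurable fun q : E1 n × En n =>
      poissonCore n t (projx n q.1 - q.2) (q.1 (Fin.last n)) := by
  have h1 : Measurable fun q : E1 n × En n => projx n q.1 :=
    (continuous_projx n).measurable.comp measurable_fst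
  have h2 : Measurable fun q : E1 n × En n => q.1 (Fin.last n) :=
    (continuous_last n).measurable.comp measurable_fst
  unfold poissonCore
  fun_prop

lemma measurable_uncurry_bdist (n : ℕ) : Measurable fun q : E1 n × En n => bdist q.1 q.2 := by
  have h1 : Measurable fun q : E1 n × En n => projx n q.1 :=
    (continuous_projx n).measurable.comp measurable_fst
  have h2 : Measurable fun q : E1 n × En n => q.1 (Fin.last n) :=
    (continuous_last n).measurable.comp measurable_fst
  unfold bdist
  fun_prop

lemma measurable_uncurry_riesz (n : ℕ) (m : ℝ) :
    Measurable fun q : En n × En n => 1 / ‖q.1 - q.2‖ ^ m - 1 / (1 + ‖q.2‖) ^ m := by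
  fun_prop

lemma lintegral_hemiMeasure_rpow_eq (n : ℕ) (a m : ℝ) :
    ∫⁻ X, ENNReal.ofReal (X (Fin.last n) ^ a) ∂(hemiMeasure n) =
      ∫⁻ X, ENNReal.ofReal (X (Fin.last n) ^ a / bdist X 0 ^ m) ∂(hemiMeasure n) := by
  refine setLIntegral_congr_fun (measurableSet_upperHemisphere n) fun X hX => ?_
  simp [bdist_zero hX.2]

lemma isFiniteMeasure_hemiMeasure {n : ℕ} (hn : 1 < n) : IsFiniteMeasure (hemiMeasure n) := by
  have hn' : (1:ℝ) < n := by exact_mod_cast hn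
  obtain ⟨C, -, h⟩ := exists_lintegral_hemiMeasure_le (n := n) (a := 0) (m := ((n:ℝ) - 1) / 2)
    (by norm_num) (by linarith) (by linarith)
  constructor
  have h0 := h 0
  rw [← lintegral_hemiMeasure_rpow_eq] at h0
  simp only [Real.rpow_zero, ENNReal.ofReal_one, lintegral_one] at h0
  exact h0.trans_lt ENNReal.ofReal_lt_top

/-- The absolute-value version of the estimate, with all integrals in `[0, ∞]`. -/
lemma exists_lintegral_hemiMeasure_poisson_riesz_le {n : ℕ} {t a m C₀ : ℝ} (ht : 1 / 2 < t)
    (ha : -1 < a) (hm : 0 < m) (hmn : m + 1 < n) (hC₀ : 0 < C₀) :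
    ∃ C > (0:ℝ), ∀ f : En n → ℝ, Measurable f →
      (∀ r : ℝ, 1 ≤ r → ∫⁻ z in Metric.ball (0 : En n) r, ENNReal.ofReal (f z) ≤
        ENNReal.ofReal (C₀ * r ^ m)) →
      ∫⁻ X, ENNReal.ofReal (X (Fin.last n) ^ a) *
        (∫⁻ z : En n, ENNReal.ofReal (poissonCore n t (projx n X - z) (X (Fin.last n))) *
          ∫⁻ ξ : En n, ENNReal.ofReal |1 / ‖z - ξ‖ ^ m - 1 / (1 + ‖ξ‖) ^ m| *
            ENNReal.ofReal (f ξ)) ∂(hemiMeasure n) ≤ ENNReal.ofReal C := by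
  obtain ⟨C₁, hC₁, h₁⟩ := exists_lintegral_poissonCore_mul_riesz_le n ht hm (by linarith)
  obtain ⟨C₂, hC₂, h₂⟩ := exists_lintegral_hemiMeasure_le ha hm hmn
  have hn1 : 1 < n := by
    have : (1:ℝ) < n := by linarith
    exact_mod_cast this
  have := isFiniteMeasure_hemiMeasure hn1
  refine ⟨2 * C₁ * C₂ * (C₀ * 2 ^ m * 2), by positivity, fun f hf hgrowth => ?_⟩
  have hk := measurable_uncurry_riesz n m
  have hy := (continuous_last n).measurable
  have hD := measurable_uncurry_bdist n
  have hpoint : ∀ X ∈ upperHemisphere n, ENNReal.ofReal (X (Fin.last n) ^ a) *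
        (∫⁻ z : En n, ENNReal.ofReal (poissonCore n t (projx n X - z) (X (Fin.last n))) *
          ∫⁻ ξ : En n, ENNReal.ofReal |1 / ‖z - ξ‖ ^ m - 1 / (1 + ‖ξ‖) ^ m| *
            ENNReal.ofReal (f ξ)) ≤
      ∫⁻ ξ : En n, ENNReal.ofReal (f ξ) * (ENNReal.ofReal (C₁ / (1 + ‖ξ‖)) *
        (ENNReal.ofReal (X (Fin.last n) ^ a / bdist X ξ ^ m) +
          ENNReal.ofReal (1 / (1 + ‖ξ‖) ^ m) * ENNReal.ofReal (X (Fin.last n) ^ a))) := by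
    intro X hX
    have hy0 : 0 < X (Fin.last n) := hX.1
    have hPm : Measurable fun z : En n =>
        poissonCore n t (projx n X - z) (X (Fin.last n)) :=
      (measurable_uncurry_poissonCore n t).comp measurable_prodMk_left
    simp_rw [← lintegral_const_mul' _ _ ENNReal.ofReal_ne_top]
    rw [lintegral_lintegral_swap]
    swap
    · apply Measurable.aemeasurable
      have h3 : Measurable fun q : En n × En n =>
          poissonCore n t (projx n X - q.1) (X (Fin.last n)) := hPm.comp measurable_fst
      simp only [Function.uncurry_def]
      fun_prop
    refine lintegral_mono fun ξ => ?_
    have hD0 : 0 < bdist X ξ := hy0.trans_le (last_le_bdist X ξ)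
    calc _ = ENNReal.ofReal (f ξ) * (ENNReal.ofReal (X (Fin.last n) ^ a) *
          ∫⁻ z : En n, ENNReal.ofReal (poissonCore n t (projx n X - z) (X (Fin.last n))) *
            ENNReal.ofReal |1 / ‖z - ξ‖ ^ m - 1 / (1 + ‖ξ‖) ^ m|) := by
          rw [← lintegral_const_mul' _ _ ENNReal.ofReal_ne_top,
            ← lintegral_const_mul' _ _ ENNReal.ofReal_ne_top]
          refine lintegral_congr fun z => ?_
          ring
      _ ≤ ENNReal.ofReal (f ξ) * (ENNReal.ofReal (X (Fin.last n) ^ a) *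
          ENNReal.ofReal (C₁ / (1 + ‖ξ‖) * (1 / bdist X ξ ^ m + 1 / (1 + ‖ξ‖) ^ m))) := by
          gcongr
          exact h₁ X hX ξ
      _ = _ := by
          congr 1
          rw [← ENNReal.ofReal_mul (by positivity), ← ENNReal.ofReal_mul (by positivity),
            ← ENNReal.ofReal_add (by positivity) (by positivity),
            ← ENNReal.ofReal_mul (by positivity)]
          congr 1
          ring
  refine (setLIntegral_mono' (measurableSet_upperHemisphere n) hpoint).trans ?_
  change ∫⁻ X, _ ∂(hemiMeasure n) ≤ _
  rw [lintegral_lintegral_swap]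
  swap
  · apply Measurable.aemeasurable
    have h3 : Measurable fun q : E1 n × En n => q.1 (Fin.last n) := hy.comp measurable_fst
    simp only [Function.uncurry_def]
    fun_prop
  have hξ : ∀ ξ : En n, ∫⁻ X, ENNReal.ofReal (f ξ) * (ENNReal.ofReal (C₁ / (1 + ‖ξ‖)) *
        (ENNReal.ofReal (X (Fin.last n) ^ a / bdist X ξ ^ m) +
          ENNReal.ofReal (1 / (1 + ‖ξ‖) ^ m) * ENNReal.ofReal (X (Fin.last n) ^ a)))
          ∂(hemiMeasure n) ≤
      ENNReal.ofReal (2 * C₁ * C₂) *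
        (ENNReal.ofReal (f ξ) * ENNReal.ofReal (1 / (1 + ‖ξ‖) ^ (m + 1))) := by
    intro ξ
    have hya : ∫⁻ X, ENNReal.ofReal (X (Fin.last n) ^ a) ∂(hemiMeasure n) ≤ ENNReal.ofReal C₂ := by
      rw [lintegral_hemiMeasure_rpow_eq n a m]
      simpa using h₂ 0
    rw [lintegral_const_mul' _ _ ENNReal.ofReal_ne_top,
      lintegral_const_mul' _ _ ENNReal.ofReal_ne_top, lintegral_add_right _ (by fun_prop),
      lintegral_const_mul' _ _ ENNReal.ofReal_ne_top]
    calc _ ≤ ENNReal.ofReal (f ξ) * (ENNReal.ofReal (C₁ / (1 + ‖ξ‖)) *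
          (ENNReal.ofReal (C₂ / (1 + ‖ξ‖) ^ m) +
            ENNReal.ofReal (1 / (1 + ‖ξ‖) ^ m) * ENNReal.ofReal C₂)) := by
          gcongr
          exact h₂ ξ
      _ = _ := by
          rw [mul_left_comm (ENNReal.ofReal (2 * C₁ * C₂))]
          congr 1
          rw [← ENNReal.ofReal_mul (by positivity),
            ← ENNReal.ofReal_add (by positivity) (by positivity),
            ← ENNReal.ofReal_mul (by positivity), ← ENNReal.ofReal_mul (by positivity),
            Real.rpow_add (by positivity), Real.rpow_one]
          congr 1
          field_simp
          ring
  refine (lintegral_mono hξ).trans ?_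
  rw [lintegral_const_mul' _ _ ENNReal.ofReal_ne_top,
    ENNReal.ofReal_mul (p := 2 * C₁ * C₂) (by positivity)]
  exact mul_le_mul' le_rfl (lintegral_mul_inv_rpow_le hm hC₀ hf hgrowth)

/-- The normalization constant `κ_{n,s}` of the Poisson kernel. -/
def kappa (n : ℕ) (s : ℝ) : ℝ :=
  Real.Gamma ((n : ℝ) / 2 + s) / (Real.Gamma s * Real.pi ^ ((n : ℝ) / 2))

lemma kappa_pos (n : ℕ) {s : ℝ} (hs : 0 < s) : 0 < kappa n s := by
  have h1 := Real.Gamma_pos_of_pos hs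
  have h2 : 0 < Real.Gamma ((n : ℝ) / 2 + s) := Real.Gamma_pos_of_pos (by positivity)
  unfold kappa
  positivity

lemma Ps_eq (n : ℕ) (s : ℝ) (x : En n) (y : ℝ) : Ps n s x y = kappa n s * poissonCore n s x y := by
  unfold Ps kappa poissonCore
  ring

lemma Ps_nonneg {n : ℕ} {s : ℝ} (hs : 0 < s) (x : En n) {y : ℝ} (hy : 0 ≤ y) : 0 ≤ Ps n s x y := by
  rw [Ps_eq]
  exact mul_nonneg (kappa_pos n hs).le (poissonCore_nonneg _ _ _ hy)

lemma measurable_uncurry_Ps (n : ℕ) (s : ℝ) :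
    Measurable fun q : E1 n × En n => Ps n s (projx n q.1 - q.2) (q.1 (Fin.last n)) := by
  simp_rw [Ps_eq]
  exact (measurable_uncurry_poissonCore n s).const_mul _

lemma lintegral_Ps {n : ℕ} {s y : ℝ} (hs : 0 < s) (hy : 0 < y) (x : En n) :
    ∫⁻ z : En n, ENNReal.ofReal (Ps n s (x - z) y) = 1 := by
  have h1 := Real.Gamma_pos_of_pos hs
  have h2 : 0 < Real.Gamma ((n : ℝ) / 2 + s) := Real.Gamma_pos_of_pos (by positivity)
  have h3 := lintegral_poisson n hs hy x
  simp_rw [Ps_eq, ENNReal.ofReal_mul (kappa_pos n hs).le]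
  rw [lintegral_const_mul' _ _ ENNReal.ofReal_ne_top]
  simp only [poissonCore]
  rw [h3, ← ENNReal.ofReal_mul (kappa_pos n hs).le, kappa, ENNReal.ofReal_eq_one]
  have : Real.pi ^ ((n : ℝ) / 2) ≠ 0 := by positivity
  field_simp

lemma integrable_Ps {n : ℕ} {s : ℝ} (hs : 0 < s) {X : E1 n} (hX : 0 < X (Fin.last n)) :
    Integrable fun z : En n => Ps n s (projx n X - z) (X (Fin.last n)) := by
  refine ⟨((measurable_uncurry_Ps n s).comp measurable_prodMk_left).aestronglyMeasurable, ?_⟩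
  rw [hasFiniteIntegral_iff_ofReal]
  · rw [lintegral_Ps hs hX]
    exact ENNReal.one_lt_top
  · exact ae_of_all _ fun z => Ps_nonneg hs _ hX.le

lemma integral_Ps {n : ℕ} {s : ℝ} (hs : 0 < s) {X : E1 n} (hX : 0 < X (Fin.last n)) :
    ∫ z : En n, Ps n s (projx n X - z) (X (Fin.last n)) = 1 := by
  rw [integral_eq_lintegral_of_nonneg_ae _ (integrable_Ps hs hX).aestronglyMeasurable,
    lintegral_Ps hs hX, ENNReal.toReal_one]
  exact ae_of_all _ fun z => Ps_nonneg hs _ hX.le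

/-- (Lemma 4.10 of the paper.) Let `1 < s < 2`, `n > 2s`, `C₀ > 0`.
There is `C > 0` such that: if `f ≥ 0` has `∫_{B_r} f ≤ C₀ r^{n-2s}` for all `r ≥ 1`,
`w(x) = c(n,s) ∫ (|x-z|^{2s-n} - (1+|z|)^{2s-n}) f(z) dz`, `u = w + c₀`, and `u_e` is the
Poisson extension of `u` to the upper half-space, then
`|∫_{∂B₁^{n+1} ∩ ℝ^{n+1}_+} y^{3-2s} u_e dσ - c_s c₀| ≤ C`, where
`c_s = ∫_{∂B₁^{n+1} ∩ ℝ^{n+1}_+} y^{3-2s} dσ`. -/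
theorem boundary_sphere_average_of_extension
    (n : ℕ) (s : ℝ) (hs1 : 1 < s) (hs2 : s < 2) (hn : 2 * s < (n : ℝ))
    (C₀ : ℝ) (hC₀ : 0 < C₀) :
    ∃ C > (0:ℝ),
      ∀ f : En n → ℝ, Measurable f → (∀ x, 0 ≤ f x) →
        (∀ r : ℝ, 1 ≤ r →
          ∫⁻ z in Metric.ball (0 : En n) r, ENNReal.ofReal (f z) ≤
            ENNReal.ofReal (C₀ * r ^ ((n : ℝ) - 2 * s))) →
        ∀ c₀ : ℝ, ∀ u : En n → ℝ,
          (∀ x : En n, u x = cRiesz n s *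
              (∫ z : En n,
                (1 / ‖x - z‖ ^ ((n : ℝ) - 2 * s) - 1 / (1 + ‖z‖) ^ ((n : ℝ) - 2 * s)) * f z)
            + c₀) →
        ∀ ue : E1 n → ℝ,
          (∀ X : E1 n, ue X = ∫ z : En n, Ps n s (projx n X - z) (X (Fin.last n)) * u z) →
          |(∫ X in {X : E1 n | 0 < X (Fin.last n)} ∩ Metric.sphere (0 : E1 n) 1,
                (X (Fin.last n)) ^ (3 - 2 * s) * ue X
                ∂(MeasureTheory.Measure.hausdorffMeasure (n : ℝ))) -
              (∫ X in {X : E1 n | 0 < X (Fin.last n)} ∩ Metric.sphere (0 : E1 n) 1,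
                (X (Fin.last n)) ^ (3 - 2 * s)
                ∂(MeasureTheory.Measure.hausdorffMeasure (n : ℝ))) * c₀| ≤ C := by
  set m : ℝ := (n : ℝ) - 2 * s with hm_def
  set a : ℝ := 3 - 2 * s with ha_def
  have hs0 : 0 < s := by linarith
  have hm : 0 < m := by linarith
  have hmn : m + 1 < n := by linarith
  have ha : -1 < a := by linarith
  obtain ⟨C₁, hC₁, hmain⟩ := exists_lintegral_hemiMeasure_poisson_riesz_le (n := n) (t := s)
    (by linarith) ha hm hmn hC₀
  obtain ⟨C₂, hC₂, hweight⟩ := exists_lintegral_hemiMeasure_le ha hm hmn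
  have hκ := kappa_pos n hs0
  have hc : 0 < cRiesz n s := by
    have h1 := Real.Gamma_pos_of_pos hs0
    have h2 : 0 < Real.Gamma ((n : ℝ) / 2 - s) := Real.Gamma_pos_of_pos (by linarith)
    unfold cRiesz
    positivity
  refine ⟨kappa n s * cRiesz n s * C₁, by positivity, ?_⟩
  intro f hf hf0 hgrowth c₀ u hu ue hue
  change |(∫ X, X (Fin.last n) ^ a * ue X ∂(hemiMeasure n)) -
    (∫ X, X (Fin.last n) ^ a ∂(hemiMeasure n)) * c₀| ≤ _
  have hae : ∀ᵐ X ∂(hemiMeasure n), X ∈ upperHemisphere n :=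
    ae_restrict_mem (measurableSet_upperHemisphere n)
  have hy := (continuous_last n).measurable
  have hk := measurable_uncurry_riesz n m
  have hP := measurable_uncurry_poissonCore n s
  set g : En n → ℝ := fun x =>
    ∫ z : En n, (1 / ‖x - z‖ ^ m - 1 / (1 + ‖z‖) ^ m) * f z
  have hgm : Measurable g := by
    refine (StronglyMeasurable.integral_prod_right (f := fun x z : En n =>
      (1 / ‖x - z‖ ^ m - 1 / (1 + ‖z‖) ^ m) * f z) ?_).measurable
    apply Measurable.stronglyMeasurable
    exact hk.mul (hf.comp measurable_snd)
  set W : En n → ℝ≥0∞ := fun z => ∫⁻ ξ : En n,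
    ENNReal.ofReal |1 / ‖z - ξ‖ ^ m - 1 / (1 + ‖ξ‖) ^ m| * ENNReal.ofReal (f ξ)
  have hWm : Measurable W := by
    refine Measurable.lintegral_prod_right' (f := fun q : En n × En n =>
      ENNReal.ofReal |1 / ‖q.1 - q.2‖ ^ m - 1 / (1 + ‖q.2‖) ^ m| * ENNReal.ofReal (f q.2)) ?_
    fun_prop
  have hgW : ∀ z, ‖g z‖ₑ ≤ W z := by
    intro z
    refine (enorm_integral_le_lintegral_enorm _).trans (le_of_eq (lintegral_congr fun ξ => ?_))
    rw [enorm_mul, Real.enorm_eq_ofReal_abs, Real.enorm_eq_ofReal (hf0 ξ)]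
  set I : E1 n → ℝ≥0∞ := fun X =>
    ∫⁻ z : En n, ENNReal.ofReal (poissonCore n s (projx n X - z) (X (Fin.last n))) * W z with hI
  have hIm : Measurable I := by
    refine Measurable.lintegral_prod_right' (f := fun q : E1 n × En n =>
      ENNReal.ofReal (poissonCore n s (projx n q.1 - q.2) (q.1 (Fin.last n))) * W q.2) ?_
    fun_prop
  have hIle : ∫⁻ X, ENNReal.ofReal (X (Fin.last n) ^ a) * I X ∂(hemiMeasure n) ≤
      ENNReal.ofReal C₁ := hmain f hf hgrowth
  have hfin : ∀ᵐ X ∂(hemiMeasure n), I X < ⊤ := by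
    filter_upwards [hae, ae_lt_top (by fun_prop)
      (ne_top_of_le_ne_top ENNReal.ofReal_ne_top hIle)] with X hX hXI
    by_contra hc
    rw [not_lt, top_le_iff] at hc
    have hpos : 0 < X (Fin.last n) ^ a := Real.rpow_pos_of_pos hX.1 _
    rw [hc, ENNReal.mul_top (by simpa using hpos)] at hXI
    exact lt_irrefl _ hXI
  set we : E1 n → ℝ := fun X =>
    ∫ z : En n, Ps n s (projx n X - z) (X (Fin.last n)) * (cRiesz n s * g z)
  have hwem : Measurable we := by
    refine (StronglyMeasurable.integral_prod_right (f := fun (X : E1 n) (z : En n) =>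
      Ps n s (projx n X - z) (X (Fin.last n)) * (cRiesz n s * g z)) ?_).measurable
    apply Measurable.stronglyMeasurable
    exact (measurable_uncurry_Ps n s).mul ((hgm.comp measurable_snd).const_mul _)
  have hlint : ∀ X ∈ upperHemisphere n,
      ∫⁻ z : En n, ‖Ps n s (projx n X - z) (X (Fin.last n)) * (cRiesz n s * g z)‖ₑ ≤
        ENNReal.ofReal (kappa n s * cRiesz n s) * I X := by
    intro X hX
    rw [hI, ← lintegral_const_mul' _ _ ENNReal.ofReal_ne_top]
    refine lintegral_mono fun z => ?_
    have hp := poissonCore_nonneg n s (projx n X - z) (le_of_lt hX.1)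
    rw [Ps_eq, enorm_mul, enorm_mul, enorm_mul, Real.enorm_eq_ofReal hκ.le,
      Real.enorm_eq_ofReal hc.le, Real.enorm_eq_ofReal hp, ENNReal.ofReal_mul hκ.le]
    calc _ = ENNReal.ofReal (kappa n s) * ENNReal.ofReal (cRiesz n s) *
          (ENNReal.ofReal (poissonCore n s (projx n X - z) (X (Fin.last n))) * ‖g z‖ₑ) := by ring
      _ ≤ _ := by
          gcongr
          exact hgW z
  have hue' : ∀ᵐ X ∂(hemiMeasure n),
      X (Fin.last n) ^ a * ue X = X (Fin.last n) ^ a * we X + X (Fin.last n) ^ a * c₀ := by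
    filter_upwards [hae, hfin] with X hX hXI
    have hInt : Integrable fun z : En n =>
        Ps n s (projx n X - z) (X (Fin.last n)) * (cRiesz n s * g z) := by
      refine ⟨(((measurable_uncurry_Ps n s).comp measurable_prodMk_left).mul
        (hgm.const_mul _)).aestronglyMeasurable, ?_⟩
      exact (hlint X hX).trans_lt (ENNReal.mul_lt_top ENNReal.ofReal_lt_top hXI)
    have hsplit : ue X = we X + c₀ := by
      rw [hue X]
      simp_rw [hu, mul_add]
      rw [integral_add hInt ((integrable_Ps hs0 hX.1).mul_const c₀), integral_mul_const,
        integral_Ps hs0 hX.1, one_mul]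
    rw [hsplit, mul_add]
  have hbound : ∫⁻ X, ‖X (Fin.last n) ^ a * we X‖ₑ ∂(hemiMeasure n) ≤
      ENNReal.ofReal (kappa n s * cRiesz n s * C₁) := by
    rw [ENNReal.ofReal_mul (by positivity)]
    refine le_trans ?_ (mul_le_mul_right hIle _)
    rw [← lintegral_const_mul' _ _ ENNReal.ofReal_ne_top]
    refine lintegral_mono_ae ?_
    filter_upwards [hae] with X hX
    rw [enorm_mul, Real.enorm_eq_ofReal (Real.rpow_nonneg (le_of_lt hX.1) _), mul_left_comm]
    gcongr
    exact (enorm_integral_le_lintegral_enorm _).trans (hlint X hX)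
  have hInt1 : Integrable (fun X : E1 n => X (Fin.last n) ^ a * we X) (hemiMeasure n) :=
    ⟨((hy.pow_const a).mul hwem).aestronglyMeasurable, hbound.trans_lt ENNReal.ofReal_lt_top⟩
  have hInt2 : Integrable (fun X : E1 n => X (Fin.last n) ^ a) (hemiMeasure n) := by
    refine ⟨(hy.pow_const a).aestronglyMeasurable, ?_⟩
    rw [hasFiniteIntegral_iff_ofReal]
    · rw [lintegral_hemiMeasure_rpow_eq n a m]
      exact (hweight 0).trans_lt ENNReal.ofReal_lt_top
    · filter_upwards [hae] with X hX
      exact Real.rpow_nonneg (le_of_lt hX.1) _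
  rw [integral_congr_ae hue', integral_add hInt1 (hInt2.mul_const c₀), integral_mul_const,
    add_sub_cancel_right, ← Real.norm_eq_abs, ← ENNReal.ofReal_le_ofReal_iff (by positivity),
    ofReal_norm]
  exact (enorm_integral_le_lintegral_enorm _).trans hbound
end
end
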